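/- Let R be a ring. If GP(R) = ^⊥(P̄(R)) and GP(R)^⊥ = P̄(R), where P̄(R) is the class of R-modules of finite projective dimension, then FPD(R) = l.Ggldim(R). -/

import Mathlib

universe u

open CategoryTheory

/-- `extVanish R n M N` asserts that `Ext_R^n(M, N) = 0`. -/
def extVanish (R : Type u) [Ring R] (n : ℕ) (M N : ModuleCat.{u} R) : Prop :=
  letI := HasDerivedCategory.standard (ModuleCat.{u} R)
  letI : HasExt.{u + 1} (ModuleCat.{u} R) := hasExt_of_hasDerivedCategory _
  Subsingleton (Abelian.Ext M N n)

/-- A module `G` is Gorenstein projective if there is an exact sequence of projective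
modules `⋯ → P i → P (i+1) → ⋯` with `G ≅ Im (d 0)` which stays exact after applying
`Hom_R(−, Q)` for every projective module `Q`. -/
def IsGorensteinProjective (R : Type u) [Ring R] (G : ModuleCat.{u} R) : Prop :=
  ∃ (P : ℤ → ModuleCat.{u} R) (d : ∀ i : ℤ, P i →ₗ[R] P (i + 1)),
    (∀ i, Module.Projective R (P i)) ∧
    (∀ i, LinearMap.range (d i) = LinearMap.ker (d (i + 1))) ∧
    Nonempty (G ≃ₗ[R] LinearMap.range (d 0)) ∧
    ∀ (Q : ModuleCat.{u} R), Module.Projective R Q →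
      ∀ (i : ℤ) (f : P (i + 1) →ₗ[R] Q), f ∘ₗ d i = 0 →
        ∃ g : P (i + 1 + 1) →ₗ[R] Q, g ∘ₗ d (i + 1) = f

/-- A module `G` is Gorenstein injective if there is an exact sequence of injective
modules `⋯ → I i → I (i+1) → ⋯` with `G ≅ Im (d 0)` which stays exact after applying
`Hom_R(E, −)` for every injective module `E`. -/
def IsGorensteinInjective (R : Type u) [Ring R] (G : ModuleCat.{u} R) : Prop :=
  ∃ (I : ℤ → ModuleCat.{u} R) (d : ∀ i : ℤ, I i →ₗ[R] I (i + 1)),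
    (∀ i, Module.Injective R (I i)) ∧
    (∀ i, LinearMap.range (d i) = LinearMap.ker (d (i + 1))) ∧
    Nonempty (G ≃ₗ[R] LinearMap.range (d 0)) ∧
    ∀ (E : ModuleCat.{u} R), Module.Injective R E →
      ∀ (i : ℤ) (f : E →ₗ[R] I (i + 1)), d (i + 1) ∘ₗ f = 0 →
        ∃ g : E →ₗ[R] I i, d i ∘ₗ g = f

/-- `gpdLE R n M` means that `M` admits a resolution `0 → Gₙ → ⋯ → G₀ → M → 0` by
Gorenstein projective modules, i.e. the Gorenstein projective dimension of `M` is at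
most `n`. -/
def gpdLE (R : Type u) [Ring R] : ℕ → ModuleCat.{u} R → Prop
  | 0, M => IsGorensteinProjective R M
  | n + 1, M => ∃ (K G : ModuleCat.{u} R) (f : K →ₗ[R] G) (g : G →ₗ[R] M),
      IsGorensteinProjective R G ∧ Function.Injective f ∧ Function.Surjective g ∧
      LinearMap.range f = LinearMap.ker g ∧ gpdLE R n K

/-- `gidLE R n M` means that `M` admits a coresolution `0 → M → G⁰ → ⋯ → Gⁿ → 0` by
Gorenstein injective modules, i.e. the Gorenstein injective dimension of `M` is at
most `n`. -/
def gidLE (R : Type u) [Ring R] : ℕ → ModuleCat.{u} R → Prop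
  | 0, M => IsGorensteinInjective R M
  | n + 1, M => ∃ (G C : ModuleCat.{u} R) (f : M →ₗ[R] G) (g : G →ₗ[R] C),
      IsGorensteinInjective R G ∧ Function.Injective f ∧ Function.Surjective g ∧
      LinearMap.range f = LinearMap.ker g ∧ gidLE R n C

/-- `projDimLE R n M` means that `M` admits a projective resolution of length at most `n`,
i.e. the projective dimension of `M` is at most `n`. -/
def projDimLE (R : Type u) [Ring R] : ℕ → ModuleCat.{u} R → Prop
  | 0, M => Module.Projective R M
  | n + 1, M => ∃ (K P : ModuleCat.{u} R) (f : K →ₗ[R] P) (g : P →ₗ[R] M),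
      Module.Projective R P ∧ Function.Injective f ∧ Function.Surjective g ∧
      LinearMap.range f = LinearMap.ker g ∧ projDimLE R n K

/-- `injDimLE R n M` means that `M` admits an injective resolution of length at most `n`,
i.e. the injective dimension of `M` is at most `n`. -/
def injDimLE (R : Type u) [Ring R] : ℕ → ModuleCat.{u} R → Prop
  | 0, M => Module.Injective R M
  | n + 1, M => ∃ (I C : ModuleCat.{u} R) (f : M →ₗ[R] I) (g : I →ₗ[R] C),
      Module.Injective R I ∧ Function.Injective f ∧ Function.Surjective g ∧
      LinearMap.range f = LinearMap.ker g ∧ injDimLE R n C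

/-- The projective dimension of `M` as an element of `ℕ∞` (`⊤` if no finite projective
resolution exists). -/
noncomputable def projDim (R : Type u) [Ring R] (M : ModuleCat.{u} R) : ℕ∞ :=
  sInf {n : ℕ∞ | ∃ m : ℕ, n = (m : ℕ∞) ∧ projDimLE R m M}

/-- The Gorenstein projective dimension of `M` as an element of `ℕ∞`. -/
noncomputable def gpd (R : Type u) [Ring R] (M : ModuleCat.{u} R) : ℕ∞ :=
  sInf {n : ℕ∞ | ∃ m : ℕ, n = (m : ℕ∞) ∧ gpdLE R m M}

/-- The finitistic projective dimension of `R`: the supremum of the projective dimensions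
of all modules of finite projective dimension. -/
noncomputable def FPD (R : Type u) [Ring R] : ℕ∞ :=
  ⨆ (M : ModuleCat.{u} R) (_ : projDim R M ≠ ⊤), projDim R M

/-- The left Gorenstein global dimension of `R`: the supremum of the Gorenstein projective
dimensions of all (left) `R`-modules. -/
noncomputable def leftGgldim (R : Type u) [Ring R] : ℕ∞ :=
  ⨆ M : ModuleCat.{u} R, gpd R M

/-- Extension of partial maps along a family of submodules closed under unions of chains. -/
theorem exists_linearMap_of_chain_closed {R : Type*} [Ring R] {U I : Type*} [AddCommGroup U]
    [Module R U] [AddCommGroup I] [Module R I] (E : Submodule R U) (C : Set (Submodule R U))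
    (hsup : ∀ c ⊆ C, IsChain (· ≤ ·) c → sSup c ∈ C)
    (hext : ∀ D ∈ C, ∀ f : D →ₗ[R] I, ∃ g : U →ₗ[R] I, ∀ x : D, g x = f x)
    (Q : U → U → I → Prop)
    (hstep : ∀ D ∈ C, D ≠ E → ∀ u : U →ₗ[R] I, (∀ x ∈ D, ∀ y ∈ D, Q x y (u y)) →
      ∃ D' ∈ C, D < D' ∧ ∃ u' : U →ₗ[R] I, (∀ x ∈ D, u' x = u x) ∧
        ∀ x ∈ D', ∀ y ∈ D', Q x y (u' y))
    (h0 : ∀ u : U →ₗ[R] I, Q 0 0 (u 0)) :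
    ∃ u : U →ₗ[R] I, ∀ x ∈ E, ∀ y ∈ E, Q x y (u y) := by
  let S : Set (U →ₗ.[R] I) := {ψ | ψ.domain ∈ C ∧
    ∀ x ∈ ψ.domain, ∀ y : ψ.domain, Q x y (ψ y)}
  have hchain : ∀ c ⊆ S, IsChain (· ≤ ·) c → ∃ ub ∈ S, ∀ z ∈ c, z ≤ ub := by
    intro c hcS hc
    rcases c.eq_empty_or_nonempty with rfl | hne
    · refine ⟨⊥, ⟨?_, ?_⟩, by simp⟩
      · change (⊥ : Submodule R U) ∈ C
        simpa using hsup ∅ (by simp) (by simp [IsChain])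
      · intro x hx y
        obtain rfl : x = 0 := (Submodule.mem_bot R).1 hx
        obtain rfl : y = 0 := Subtype.ext ((Submodule.mem_bot R).1 y.2)
        simpa using h0 0
    · have hdir : DirectedOn (· ≤ ·) c := hc.directedOn
      have hdir' : DirectedOn (· ≤ ·) (LinearPMap.domain '' c) := by
        rintro _ ⟨a, ha, rfl⟩ _ ⟨b, hb, rfl⟩
        obtain ⟨e, he, hae, hbe⟩ := hdir a ha b hb
        exact ⟨_, ⟨e, he, rfl⟩, hae.1, hbe.1⟩
      have hdom : (LinearPMap.sSup c hdir).domain = sSup (LinearPMap.domain '' c) := rfl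
      refine ⟨LinearPMap.sSup c hdir, ⟨?_, ?_⟩, fun z hz => LinearPMap.le_sSup hdir hz⟩
      · rw [hdom]
        apply hsup
        · rintro _ ⟨a, ha, rfl⟩
          exact (hcS ha).1
        · rintro _ ⟨a, ha, rfl⟩ _ ⟨b, hb, rfl⟩ hne'
          exact (hc ha hb fun h => hne' (h ▸ rfl)).imp (fun h => h.1) fun h => h.1
      · intro x hx y
        obtain ⟨y, hy⟩ := y
        have hx' := hx
        have hy' := hy
        rw [hdom, Submodule.mem_sSup_of_directed (hne.image _) hdir'] at hx' hy'
        obtain ⟨_, ⟨a, ha, rfl⟩, hxa⟩ := hx'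
        obtain ⟨_, ⟨b, hb, rfl⟩, hyb⟩ := hy'
        obtain ⟨e, he, hae, hbe⟩ := hdir a ha b hb
        have := (hcS he).2 x (hae.1 hxa) ⟨y, hbe.1 hyb⟩
        rwa [(LinearPMap.le_sSup hdir he).2 (y := ⟨y, hy⟩) rfl] at this
  obtain ⟨ψ, hψ⟩ := zorn_le₀ S hchain
  obtain ⟨u, hu⟩ := hext _ hψ.prop.1 ψ.toFun
  have hQ : ∀ x ∈ ψ.domain, ∀ y ∈ ψ.domain, Q x y (u y) := by
    intro x hx y hy
    have := hψ.prop.2 x hx ⟨y, hy⟩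
    rwa [← LinearPMap.toFun_eq_coe, ← hu] at this
  by_cases hE : ψ.domain = E
  · exact ⟨u, hE ▸ hQ⟩
  · obtain ⟨D', hD', hlt, u', hu', hQ'⟩ := hstep _ hψ.prop.1 hE u hQ
    have hmem : (⟨D', u'.comp D'.subtype⟩ : U →ₗ.[R] I) ∈ S :=
      ⟨hD', fun x hx y => hQ' x hx y y.2⟩
    have hle : ψ ≤ ⟨D', u'.comp D'.subtype⟩ := by
      refine ⟨hlt.le, fun x y hxy => ?_⟩
      change ψ.toFun x = u' y
      rw [← hu, ← hxy, hu' _ x.2]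
    exact absurd (hψ.le_of_ge hmem hle).1 hlt.not_ge

theorem extVanish_iff {R : Type u} [Ring R] (n : ℕ) (M N : ModuleCat.{u} R) :
    extVanish R n M N ↔ Subsingleton (Abelian.Ext.{u} M N n) := by
  let := HasDerivedCategory.standard (ModuleCat.{u} R)
  exact (@Abelian.Ext.chgUniv.{u} _ _ _ (hasExt_of_hasDerivedCategory _) _ M N n).subsingleton_congr

/-- The modules of finite projective dimension. -/
def FinitePD (R : Type u) [Ring R] (N : Type u) [AddCommGroup N] [Module R N] : Prop :=
  ∃ n, HasProjectiveDimensionLT (ModuleCat.of R N) n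

section
variable {R : Type u} [Ring R]

theorem shortExact_of_linearMap {K P M : ModuleCat.{u} R} (f : K →ₗ[R] P) (g : P →ₗ[R] M)
    (hf : Function.Injective f) (hg : Function.Surjective g)
    (h : LinearMap.range f = LinearMap.ker g) :
    (ShortComplex.mk (ModuleCat.ofHom f) (ModuleCat.ofHom g) (by
      ext x
      exact LinearMap.mem_ker.1 (h.le ⟨x, rfl⟩))).ShortExact := by
  apply ModuleCat.shortComplex_shortExact
  · intro x
    exact (SetLike.ext_iff.1 h x).symm
  · exact hf
  · exact hg

theorem projDimLE_iff (n : ℕ) (M : ModuleCat.{u} R) :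
    projDimLE R n M ↔ HasProjectiveDimensionLT M (n + 1) := by
  induction n generalizing M with
  | zero =>
    rw [projDimLE, zero_add, ← projective_iff_hasProjectiveDimensionLT_one]
    exact IsProjective.iff_projective M
  | succ n ih =>
    constructor
    · rintro ⟨K, P, f, g, hP, hf, hg, h, hK⟩
      have hP' : Projective P := (IsProjective.iff_projective P).1 hP
      exact ((shortExact_of_linearMap f g hf hg h).hasProjectiveDimensionLT_X₃_iff n hP').2
        ((ih K).1 hK)
    · intro h
      let g := Finsupp.linearCombination R (id : M → M)
      have hg : Function.Surjective g := Finsupp.linearCombination_id_surjective R M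
      refine ⟨ModuleCat.of R (LinearMap.ker g), ModuleCat.of R (M →₀ R), (LinearMap.ker g).subtype,
        g, by dsimp; infer_instance, Subtype.val_injective, hg, by simp, ?_⟩
      rw [ih]
      have hP' : Projective (ModuleCat.of R (M →₀ R)) :=
        (IsProjective.iff_projective (M →₀ R)).1 inferInstance
      exact ((shortExact_of_linearMap (K := ModuleCat.of R (LinearMap.ker g))
        (P := ModuleCat.of R (M →₀ R)) (LinearMap.ker g).subtype g
        Subtype.val_injective hg (by simp)).hasProjectiveDimensionLT_X₃_iff n hP').1 h

theorem projDim_ne_top_iff (M : ModuleCat.{u} R) : projDim R M ≠ ⊤ ↔ FinitePD R M := by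
  rw [projDim, ← lt_top_iff_ne_top, sInf_lt_iff]
  constructor
  · rintro ⟨_, ⟨m, rfl, hm⟩, -⟩
    exact ⟨_, (projDimLE_iff m M).1 hm⟩
  · rintro ⟨n, hn⟩
    have : HasProjectiveDimensionLT M n := hn
    exact ⟨n, ⟨n, rfl, (projDimLE_iff n M).2 (hasProjectiveDimensionLT_of_ge M n _ (by omega))⟩,
      by simp⟩

end

section
variable {R : Type u} [Ring R]

open Abelian

namespace CategoryTheory.ShortComplex.ShortExact

variable {S : ShortComplex (ModuleCat.{u} R)} (hS : S.ShortExact)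
include hS

theorem exists_extension {B : ModuleCat.{u} R} (h : Subsingleton (Ext.{u} S.X₃ B 1))
    (φ : S.X₁ ⟶ B) : ∃ ψ : S.X₂ ⟶ B, S.f ≫ ψ = φ := by
  obtain ⟨x, hx⟩ := Ext.contravariant_sequence_exact₁ hS B (Ext.mk₀ φ) (n₁ := 1) rfl
    (Subsingleton.elim _ _)
  obtain ⟨ψ, rfl⟩ := Ext.homEquiv₀.symm.surjective x
  exact ⟨ψ, Ext.homEquiv₀.symm.injective (by simpa using hx)⟩

theorem subsingleton_ext_one_of_extension {B : ModuleCat.{u} R}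
    (h : Subsingleton (Ext.{u} S.X₂ B 1))
    (hext : ∀ φ : S.X₁ ⟶ B, ∃ ψ : S.X₂ ⟶ B, S.f ≫ ψ = φ) : Subsingleton (Ext.{u} S.X₃ B 1) := by
  refine subsingleton_of_forall_eq 0 fun e => ?_
  obtain ⟨x, rfl⟩ := Ext.contravariant_sequence_exact₃ hS B e (Subsingleton.elim _ _)
    (n₀ := 0) rfl
  obtain ⟨φ, rfl⟩ := Ext.homEquiv₀.symm.surjective x
  obtain ⟨ψ, rfl⟩ := hext φ
  simp only [Ext.homEquiv₀_symm_apply, ← Ext.mk₀_comp_mk₀, extClass_comp_assoc]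

theorem exists_lifting {X : ModuleCat.{u} R} (h : Subsingleton (Ext.{u} X S.X₁ 1))
    (φ : X ⟶ S.X₃) : ∃ ψ : X ⟶ S.X₂, ψ ≫ S.g = φ := by
  obtain ⟨x, hx⟩ := Ext.covariant_sequence_exact₃ X hS (Ext.mk₀ φ) (n₁ := 1) rfl
    (Subsingleton.elim _ _)
  obtain ⟨ψ, rfl⟩ := Ext.homEquiv₀.symm.surjective x
  exact ⟨ψ, Ext.homEquiv₀.symm.injective (by simpa using hx)⟩

theorem subsingleton_ext_one_of_lifting {X : ModuleCat.{u} R}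
    (h : Subsingleton (Ext.{u} X S.X₂ 1))
    (hext : ∀ φ : X ⟶ S.X₃, ∃ ψ : X ⟶ S.X₂, ψ ≫ S.g = φ) : Subsingleton (Ext.{u} X S.X₁ 1) := by
  refine subsingleton_of_forall_eq 0 fun e => ?_
  obtain ⟨x, rfl⟩ := Ext.covariant_sequence_exact₁ X hS e (Subsingleton.elim _ _)
    (n₀ := 0) rfl
  obtain ⟨φ, rfl⟩ := Ext.homEquiv₀.symm.surjective x
  obtain ⟨ψ, rfl⟩ := hext φ
  simp only [Ext.homEquiv₀_symm_apply, ← Ext.mk₀_comp_mk₀,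
    Ext.comp_assoc_of_second_deg_zero, comp_extClass, Ext.comp_zero]

theorem subsingleton_ext_covariant₁ {X : ModuleCat.{u} R} {n : ℕ}
    (h₃ : Subsingleton (Ext.{u} X S.X₃ n)) (h₂ : Subsingleton (Ext.{u} X S.X₂ (n + 1))) :
    Subsingleton (Ext.{u} X S.X₁ (n + 1)) := by
  refine subsingleton_of_forall_eq 0 fun e => ?_
  obtain ⟨x, rfl⟩ := Ext.covariant_sequence_exact₁ X hS e (Subsingleton.elim _ _) rfl
  rw [Subsingleton.elim x 0, Ext.zero_comp]

theorem subsingleton_ext_covariant₃ {X : ModuleCat.{u} R} {n : ℕ}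
    (h₂ : Subsingleton (Ext.{u} X S.X₂ n)) (h₁ : Subsingleton (Ext.{u} X S.X₁ (n + 1))) :
    Subsingleton (Ext.{u} X S.X₃ n) := by
  refine subsingleton_of_forall_eq 0 fun e => ?_
  obtain ⟨x, rfl⟩ := Ext.covariant_sequence_exact₃ X hS e rfl (Subsingleton.elim _ _)
  rw [Subsingleton.elim x 0, Ext.zero_comp]

theorem subsingleton_ext_contravariant₁ {Y : ModuleCat.{u} R} {n : ℕ}
    (h₂ : Subsingleton (Ext.{u} S.X₂ Y n)) (h₃ : Subsingleton (Ext.{u} S.X₃ Y (n + 1))) :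
    Subsingleton (Ext.{u} S.X₁ Y n) := by
  refine subsingleton_of_forall_eq 0 fun e => ?_
  obtain ⟨x, rfl⟩ := Ext.contravariant_sequence_exact₁ hS Y e (add_comm 1 n)
    (Subsingleton.elim _ _)
  rw [Subsingleton.elim x 0, Ext.comp_zero]

theorem subsingleton_ext_contravariant₃ {Y : ModuleCat.{u} R} {n : ℕ}
    (h₁ : Subsingleton (Ext.{u} S.X₁ Y n)) (h₂ : Subsingleton (Ext.{u} S.X₂ Y (n + 1))) :
    Subsingleton (Ext.{u} S.X₃ Y (n + 1)) := by
  refine subsingleton_of_forall_eq 0 fun e => ?_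
  obtain ⟨x, rfl⟩ := Ext.contravariant_sequence_exact₃ hS Y e (Subsingleton.elim _ _)
    (add_comm 1 n)
  rw [Subsingleton.elim x 0, Ext.comp_zero]

end CategoryTheory.ShortComplex.ShortExact

theorem subsingleton_ext_of_projective (P Y : ModuleCat.{u} R) [Projective P] (n : ℕ) :
    Subsingleton (Ext.{u} P Y (n + 1)) :=
  HasProjectiveDimensionLT.subsingleton P 1 (n + 1) (by omega) Y

theorem subsingleton_ext_of_injective (X I : ModuleCat.{u} R) [Injective I] (n : ℕ) :
    Subsingleton (Ext.{u} X I (n + 1)) :=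
  subsingleton_of_forall_eq 0 fun e => e.eq_zero_of_injective

/-- Injective presentation of a module. -/
theorem exists_injective_ses (N : ModuleCat.{u} R) :
    ∃ S : ShortComplex (ModuleCat.{u} R), S.ShortExact ∧ S.X₁ = N ∧ Injective S.X₂ := by
  refine ⟨ShortComplex.mk (Injective.ι N) (Limits.cokernel.π (Injective.ι N)) (by simp), ?_, rfl,
    by dsimp; infer_instance⟩
  exact { exact := ShortComplex.exact_of_g_is_cokernel _ (Limits.cokernelIsCokernel _) }

theorem exists_projective_ses (N : ModuleCat.{u} R) :
    ∃ S : ShortComplex (ModuleCat.{u} R), S.ShortExact ∧ S.X₃ = N ∧ Projective S.X₂ := by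
  refine ⟨ShortComplex.mk (Limits.kernel.ι (Projective.π N)) (Projective.π N) (by simp), ?_, rfl,
    by dsimp; infer_instance⟩
  exact { exact := ShortComplex.exact_of_f_is_kernel _ (Limits.kernelIsKernel _) }

end

section
variable {R : Type u} [Ring R]

open Abelian

theorem exists_dimension_shift (n : ℕ) (N : ModuleCat.{u} R) : ∃ C : ModuleCat.{u} R,
    ∀ X : ModuleCat.{u} R, Subsingleton (Ext.{u} X N (n + 1)) ↔ Subsingleton (Ext.{u} X C 1) := by
  induction n generalizing N with
  | zero => exact ⟨N, fun X => Iff.rfl⟩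
  | succ n ih =>
    obtain ⟨S, hS, rfl, hI⟩ := exists_injective_ses N
    obtain ⟨C, hC⟩ := ih S.X₃
    refine ⟨C, fun X => ?_⟩
    rw [← hC X]
    exact ⟨fun h => hS.subsingleton_ext_covariant₃ (subsingleton_ext_of_injective _ _ _) h,
      fun h => hS.subsingleton_ext_covariant₁ h (subsingleton_ext_of_injective _ _ _)⟩

theorem exists_extension_of_injective {I : ModuleCat.{u} R} [Injective I] {U : Type u}
    [AddCommGroup U] [Module R U] (D : Submodule R U) (f : D →ₗ[R] I) :
    ∃ g : U →ₗ[R] I, ∀ x : D, g x = f x := by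
  have : Mono (ModuleCat.ofHom D.subtype) :=
    (ModuleCat.mono_iff_injective _).2 Subtype.val_injective
  refine ⟨(Injective.factorThru (ModuleCat.ofHom f) (ModuleCat.ofHom D.subtype)).hom, fun x => ?_⟩
  have := Injective.comp_factorThru (ModuleCat.ofHom f) (ModuleCat.ofHom D.subtype)
  exact ConcreteCategory.congr_hom this x

/-- Auslander's lemma for families of submodules that are closed under unions of chains. -/
theorem hasProjectiveDimensionLT_of_chain_closed {U : Type u} [AddCommGroup U] [Module R U] (n : ℕ)
    (E : Submodule R U) (C : Set (Submodule R U)) (hle : ∀ D ∈ C, D ≤ E)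
    (hsup : ∀ c ⊆ C, IsChain (· ≤ ·) c → sSup c ∈ C)
    (hstep : ∀ D ∈ C, D ≠ E → ∃ D' ∈ C, D < D' ∧
      HasProjectiveDimensionLT (ModuleCat.of R (D' ⧸ D.submoduleOf D')) (n + 1)) :
    HasProjectiveDimensionLT (ModuleCat.of R E) (n + 1) := by
  refine hasProjectiveDimensionLT_of_enoughInjectives _ _ fun Y => ?_
  obtain ⟨Y', hY'⟩ := exists_dimension_shift n Y
  rw [hY']
  obtain ⟨S, hS, rfl, hI⟩ := exists_injective_ses Y'
  refine hS.subsingleton_ext_one_of_lifting (subsingleton_ext_of_injective _ _ _) fun φ => ?_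
  suffices ∃ u : U →ₗ[R] S.X₂, ∀ x ∈ E, ∀ y ∈ E,
      ∀ hy : y ∈ E, S.g.hom (u y) = φ.hom ⟨y, hy⟩ by
    obtain ⟨u, hu⟩ := this
    exact ⟨ModuleCat.ofHom (u ∘ₗ E.subtype), ModuleCat.hom_ext <| LinearMap.ext fun y =>
      hu y y.2 y y.2 y.2⟩
  refine exists_linearMap_of_chain_closed E C hsup
    (fun D _ f => exists_extension_of_injective D f)
    (fun _ y b => ∀ hy : y ∈ E, S.g.hom b = φ.hom ⟨y, hy⟩) ?_
    (fun u _ => by rw [map_zero, map_zero]; exact (map_zero φ.hom).symm)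
  intro D hD hne u hu
  obtain ⟨D', hD', hlt, hpd⟩ := hstep D hD hne
  let δ : D' →ₗ[R] S.X₃ := φ.hom ∘ₗ Submodule.inclusion (hle D' hD') - S.g.hom ∘ₗ u ∘ₗ D'.subtype
  have hδ : D.submoduleOf D' ≤ LinearMap.ker δ := fun x hx =>
    sub_eq_zero.2 (hu x hx x hx (hle _ hD hx)).symm
  have hE : Subsingleton (Ext.{u} (ModuleCat.of R (D' ⧸ D.submoduleOf D')) S.X₁ 1) :=
    (hY' _).1 (HasProjectiveDimensionLT.subsingleton _ (n + 1) _ le_rfl _)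
  obtain ⟨l, hl⟩ := hS.exists_lifting hE (ModuleCat.ofHom ((D.submoduleOf D').liftQ δ hδ))
  obtain ⟨w, hw⟩ := exists_extension_of_injective D' (l.hom ∘ₗ (D.submoduleOf D').mkQ)
  refine ⟨D', hD', hlt, u + w, fun x hx => ?_, fun _ _ y hy hy' => ?_⟩
  · have h0 : (D.submoduleOf D').mkQ ⟨x, hlt.le hx⟩ = 0 :=
      (Submodule.Quotient.mk_eq_zero _).2 hx
    have := hw ⟨x, hlt.le hx⟩
    rw [LinearMap.comp_apply, h0, map_zero] at this
    simpa using this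
  · have h1 := ConcreteCategory.congr_hom hl ((D.submoduleOf D').mkQ ⟨y, hy⟩)
    have h2 := hw ⟨y, hy⟩
    have h3 : S.g.hom (l.hom ((D.submoduleOf D').mkQ ⟨y, hy⟩)) = φ.hom ⟨y, hy'⟩ - S.g.hom (u y) :=
      h1
    have h4 : w y = l.hom ((D.submoduleOf D').mkQ ⟨y, hy⟩) := h2
    rw [LinearMap.add_apply, map_add, h4, h3]
    abel

section FinitePD

variable {A B C : Type u} [AddCommGroup A] [Module R A] [AddCommGroup B] [Module R B]
  [AddCommGroup C] [Module R C]

theorem FinitePD.of_linearEquiv (e : A ≃ₗ[R] B) (h : FinitePD R A) : FinitePD R B :=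
  h.imp fun n hn =>
    have : HasProjectiveDimensionLT (ModuleCat.of R A) n := hn
    hasProjectiveDimensionLT_of_iso e.toModuleIso n

theorem FinitePD.of_projective [Module.Projective R A] : FinitePD R A :=
  ⟨1, projective_iff_hasProjectiveDimensionLT_one.1
    ((IsProjective.iff_projective A).1 inferInstance)⟩

theorem FinitePD.quotient (A' : Submodule R A) (h : FinitePD R A) (h' : FinitePD R A') :
    FinitePD R (A ⧸ A') := by
  obtain ⟨n, hn⟩ := h
  obtain ⟨m, hm⟩ := h'
  refine ⟨max n m + 1, (shortExact_of_linearMap (K := ModuleCat.of R A') (P := ModuleCat.of R A)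
    (M := ModuleCat.of R (A ⧸ A')) A'.subtype A'.mkQ Subtype.val_injective
    (Submodule.mkQ_surjective _) (by simp)).hasProjectiveDimensionLT_X₃ (max n m) ?_ ?_⟩
  · exact hasProjectiveDimensionLT_of_ge _ m _ (le_max_right _ _)
  · exact hasProjectiveDimensionLT_of_ge _ n _ ((le_max_left _ _).trans (Nat.le_succ _))

end FinitePD

/-- `GP(R)^⊥ = P̄(R)` -/
def RightOrth (R : Type u) [Ring R] : Prop := ∀ M : ModuleCat.{u} R,
  (∀ G, IsGorensteinProjective R G → Subsingleton (Ext.{u} G M 1)) ↔ FinitePD R M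

namespace RightOrth

variable (h : RightOrth R)
include h

theorem finitePD_of_injective (I : ModuleCat.{u} R) [Injective I] : FinitePD R I :=
  (h I).1 fun _ _ => subsingleton_ext_of_injective _ _ _

theorem finitePD_pi {ι : Type u} (N : ι → Type u) [∀ i, AddCommGroup (N i)]
    [∀ i, Module R (N i)] (hN : ∀ i, FinitePD R (N i)) : FinitePD R (∀ i, N i) := by
  refine (h (ModuleCat.of R (∀ i, N i))).1 fun G hG => ?_
  obtain ⟨S, hS, rfl, hP⟩ := exists_projective_ses G
  refine hS.subsingleton_ext_one_of_extension (subsingleton_ext_of_projective _ _ _) fun φ => ?_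
  choose ψ hψ using fun i => hS.exists_extension ((h (ModuleCat.of R (N i))).2 (hN i) _ hG)
    (φ ≫ ModuleCat.ofHom (LinearMap.proj i))
  refine ⟨ModuleCat.ofHom (LinearMap.pi fun i => (ψ i).hom), ?_⟩
  ext x i
  exact ConcreteCategory.congr_hom (hψ i) x

theorem exists_bound : ∃ n : ℕ, ∀ (N : Type u) [AddCommGroup N] [Module R N], FinitePD R N →
    HasProjectiveDimensionLT (ModuleCat.of R N) (n + 1) := by
  by_contra! hcon
  choose N i1 i2 hN hlt using hcon
  obtain ⟨m, hm⟩ := h.finitePD_pi (ι := ULift.{u} ℕ) (fun i => N i.down) fun i => hN _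
  refine hlt m ?_
  have : HasProjectiveDimensionLT (ModuleCat.of R (∀ i : ULift.{u} ℕ, N i.down)) (m + 1) :=
    hasProjectiveDimensionLT_of_ge _ m _ (Nat.le_succ _)
  classical
  refine Retract.hasProjectiveDimensionLT (Y := ModuleCat.of R (∀ i : ULift.{u} ℕ, N i.down))
    ⟨ModuleCat.ofHom (LinearMap.single R (fun i : ULift.{u} ℕ => N i.down) ⟨m⟩),
      ModuleCat.ofHom (LinearMap.proj (⟨m⟩ : ULift.{u} ℕ)), ?_⟩ (m + 1)
  ext x
  simp

end RightOrth
end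

section
variable {R : Type u} [Ring R]

theorem FinitePD.sup_quotient {A : Type u} [AddCommGroup A] [Module R A] (p p' : Submodule R A)
    (hp : FinitePD R p) (h : FinitePD R (p ⊓ p' : Submodule R A)) :
    FinitePD R (↥(p ⊔ p') ⧸ p'.submoduleOf (p ⊔ p')) :=
  .of_linearEquiv (LinearMap.quotientInfEquivSupQuotient p p') <|
    hp.quotient _ (.of_linearEquiv (Submodule.submoduleOfEquivOfLe inf_le_left).symm h)

section
variable {𝒟 : Type u} (Q : 𝒟 → Type u) [∀ a, AddCommGroup (Q a)] [∀ a, Module R (Q a)]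

variable (R) in
/-- The elements of a product that are supported in `Y`. -/
def piSupported (Y : Set 𝒟) : Submodule R (∀ a, Q a) where
  carrier := {q | ∀ a ∉ Y, q a = 0}
  add_mem' hp hq a ha := by simp [hp a ha, hq a ha]
  zero_mem' := by simp
  smul_mem' c q hq a ha := by simp [hq a ha]

open Classical in
/-- The elements of a product supported in `Y` form the product over `Y`. -/
noncomputable def piSupportedEquiv (Y : Set 𝒟) : piSupported R Q Y ≃ₗ[R] ∀ a : Y, Q a where
  toFun q a := q.1 a
  map_add' _ _ := rfl
  map_smul' _ _ := rfl
  invFun q := ⟨fun a => if h : a ∈ Y then q ⟨a, h⟩ else 0, fun a ha => dif_neg ha⟩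
  left_inv q := by
    ext a
    by_cases h : a ∈ Y
    · simp [h]
    · simp [h, q.2 a h]
  right_inv q := by
    ext a
    simp

variable {ι : Type u} (X : ι → Set 𝒟)

variable (R) in
/-- The elements of a product supported in `Y` and in a finite union of sets `X j`, `j ∈ A`. -/
def piFinSupported (A : Set ι) (Y : Set 𝒟) : Submodule R (∀ a, Q a) where
  carrier := {q | (∀ a ∉ Y, q a = 0) ∧
    ∃ t : Finset ι, ↑t ⊆ A ∧ ∀ a, (∀ j ∈ t, a ∉ X j) → q a = 0}
  add_mem' := by
    classical
    rintro p q ⟨hp, t, ht, htp⟩ ⟨hq, s, hs, hsq⟩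
    refine ⟨fun a ha => by simp [hp a ha, hq a ha], t ∪ s, by simp [ht, hs], fun a ha => ?_⟩
    simp [htp a fun j hj => ha j (by simp [hj]), hsq a fun j hj => ha j (by simp [hj])]
  zero_mem' := ⟨by simp, ∅, by simp⟩
  smul_mem' := by
    rintro c q ⟨hq, t, ht, htq⟩
    exact ⟨fun a ha => by simp [hq a ha], t, ht, fun a ha => by simp [htq a ha]⟩

theorem piFinSupported_mono {A A' : Set ι} (h : A ⊆ A') (Y : Set 𝒟) :
    piFinSupported R Q X A Y ≤ piFinSupported R Q X A' Y :=
  fun _ ⟨hq, t, ht, htq⟩ => ⟨hq, t, ht.trans h, htq⟩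

theorem piFinSupported_le_of_forall_Iic [LinearOrder ι] {A : Set ι} {Y : Set 𝒟}
    {D : Submodule R (∀ a, Q a)} (h : ∀ k ∈ A, piFinSupported R Q X (Set.Iic k) Y ≤ D) :
    piFinSupported R Q X A Y ≤ D := by
  rintro q ⟨hq, t, ht, htq⟩
  rcases t.eq_empty_or_nonempty with rfl | hne
  · rw [show q = 0 from funext fun a => htq a (by simp)]
    exact zero_mem _
  · exact h _ (ht (t.max'_mem hne)) ⟨hq, t, fun j hj => t.le_max' j hj, htq⟩

theorem piSupported_sup [LinearOrder ι] (k : ι) (Y : Set 𝒟) :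
    piSupported R Q (X k ∩ Y) ⊔ piFinSupported R Q X (Set.Iio k) Y =
      piFinSupported R Q X (Set.Iic k) Y := by
  classical
  apply le_antisymm
  · refine sup_le (fun q hq => ⟨fun a ha => hq a fun h => ha h.2, {k}, by simp, fun a ha => ?_⟩)
      (piFinSupported_mono Q X Set.Iio_subset_Iic_self Y)
    exact hq a fun h => ha k (by simp) h.1
  · rintro q ⟨hq, t, ht, htq⟩
    refine Submodule.mem_sup.2 ⟨fun a => if a ∈ X k then q a else 0, fun a ha => ?_,
      fun a => if a ∈ X k then 0 else q a, ⟨fun a ha => ?_, t.erase k, fun j hj => ?_,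
        fun a ha => ?_⟩, ?_⟩
    · by_cases h : a ∈ X k
      · simp [hq a fun hY => ha ⟨h, hY⟩]
      · simp [h]
    · simp [hq a ha]
    · rw [Finset.mem_coe, Finset.mem_erase] at hj
      exact lt_of_le_of_ne (ht hj.2) hj.1
    · by_cases h : a ∈ X k
      · simp [h]
      · simp only [h, if_false]
        refine htq a fun j hj => ?_
        by_cases hjk : j = k
        · exact hjk ▸ h
        · exact ha j (Finset.mem_erase.2 ⟨hjk, hj⟩)
    · ext a
      by_cases h : a ∈ X k <;> simp [h]

theorem piSupported_inf {A : Set ι} (k : ι) (Y : Set 𝒟) :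
    piSupported R Q (X k ∩ Y) ⊓ piFinSupported R Q X A Y =
      piFinSupported R Q X A (X k ∩ Y) := by
  ext q
  exact ⟨fun ⟨h1, h2⟩ => ⟨h1, h2.2⟩, fun h => ⟨h.1, fun a ha => h.1 a fun h' => ha h'.2, h.2⟩⟩

variable (h : RightOrth R) (hQ : ∀ a, FinitePD R (Q a))
include h hQ

theorem RightOrth.finitePD_piFinSupported_aux [LinearOrder ι] [WellFoundedLT ι] (A₀ : Set ι)
    (hlow : IsLowerSet A₀)
    (hA₀ : ∀ k ∈ A₀, ∀ Y, FinitePD R (piFinSupported R Q X (Set.Iio k) Y))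
    (Y : Set 𝒟) : FinitePD R (piFinSupported R Q X A₀ Y) := by
  obtain ⟨n, hn⟩ := h.exists_bound
  refine ⟨n + 1, hasProjectiveDimensionLT_of_chain_closed n (piFinSupported R Q X A₀ Y)
    {D | ∃ A : Set ι, IsLowerSet A ∧ A ⊆ A₀ ∧ D = piFinSupported R Q X A Y} ?_ ?_ ?_⟩
  · rintro _ ⟨A, -, hA, rfl⟩
    exact piFinSupported_mono Q X hA Y
  · intro c hc _
    refine ⟨⋃₀ {A | IsLowerSet A ∧ A ⊆ A₀ ∧ piFinSupported R Q X A Y ∈ c},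
      isLowerSet_sUnion fun A hA => hA.1, Set.sUnion_subset fun A hA => hA.2.1, ?_⟩
    apply le_antisymm
    · refine sSup_le fun D hD => ?_
      obtain ⟨A, hA, hA', rfl⟩ := hc hD
      have : A ∈ {A | IsLowerSet A ∧ A ⊆ A₀ ∧ piFinSupported R Q X A Y ∈ c} := ⟨hA, hA', hD⟩
      exact piFinSupported_mono Q X (Set.subset_sUnion_of_mem this) Y
    · refine piFinSupported_le_of_forall_Iic Q X ?_
      rintro k ⟨A, ⟨hA, hA', hD⟩, hk⟩
      exact (piFinSupported_mono Q X (hA.Iic_subset hk) Y).trans (le_sSup hD)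
  · rintro _ ⟨A, hA, hA', rfl⟩ hne
    have hex : ∃ k ∈ A₀, ¬ piFinSupported R Q X (Set.Iic k) Y ≤ piFinSupported R Q X A Y := by
      by_contra! hcon
      exact hne (le_antisymm (piFinSupported_mono Q X hA' Y)
        (piFinSupported_le_of_forall_Iic Q X hcon))
    obtain ⟨k, ⟨hk, hkA⟩, hmin⟩ := WellFounded.has_min (wellFounded_lt (α := ι))
      {k | k ∈ A₀ ∧ ¬ piFinSupported R Q X (Set.Iic k) Y ≤ piFinSupported R Q X A Y} hex
    have hIio : piFinSupported R Q X A Y = piFinSupported R Q X (Set.Iio k) Y := by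
      refine le_antisymm (piFinSupported_mono Q X (fun a ha => ?_) Y)
        (piFinSupported_le_of_forall_Iic Q X fun j hj => ?_)
      · by_contra hle
        exact hkA (piFinSupported_mono Q X (hA.Iic_subset (hA (not_lt.1 hle) ha)) Y)
      · by_contra hcon
        exact hmin j ⟨hlow (le_of_lt hj) hk, hcon⟩ hj
    rw [hIio] at hkA ⊢
    refine ⟨_, ⟨Set.Iic k, isLowerSet_Iic k, hlow.Iic_subset hk, rfl⟩,
      lt_of_le_not_ge (piFinSupported_mono Q X Set.Iio_subset_Iic_self Y) hkA, ?_⟩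
    rw [← piSupported_sup]
    refine hn _ (.sup_quotient _ _ (.of_linearEquiv (piSupportedEquiv Q _).symm
      (h.finitePD_pi _ fun a => hQ a)) ?_)
    rw [piSupported_inf]
    exact hA₀ k hk _

theorem RightOrth.finitePD_piFinSupported :
    FinitePD R (piFinSupported R Q X Set.univ Set.univ) := by
  obtain ⟨_, _⟩ := exists_wellFoundedLT ι
  refine h.finitePD_piFinSupported_aux Q X hQ _ isLowerSet_univ (fun k _ => ?_) _
  induction k using WellFoundedLT.induction with
  | ind k ih =>
    exact h.finitePD_piFinSupported_aux Q X hQ _ (isLowerSet_Iio k) fun j hj => ih j hj trivial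
end
end

section
variable {R : Type u} [Ring R]

/-- `Hom(F, B)` is exact at `F` with respect to the endomorphism `d`. -/
def HomExact {F B : Type*} [AddCommGroup F] [Module R F] [AddCommGroup B] [Module R B]
    (d : F →ₗ[R] F) : Prop :=
  ∀ f : F →ₗ[R] B, f ∘ₗ d = 0 → ∃ u : F →ₗ[R] B, u ∘ₗ d = f

/-- A differential `d` such that `Hom(-, N)` is exact for all `N` of finite projective dimension. -/
structure IsTac {F : Type u} [AddCommGroup F] [Module R F] (d : F →ₗ[R] F) : Prop where
  sq : ∀ x, d (d x) = 0
  homExact : ∀ (N : Type u) [AddCommGroup N] [Module R N], FinitePD R N → HomExact (B := N) d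

theorem HomExact.of_conj {F F' B : Type*} [AddCommGroup F] [Module R F] [AddCommGroup F']
    [Module R F'] [AddCommGroup B] [Module R B] {d : F →ₗ[R] F} (e : F ≃ₗ[R] F')
    (h : HomExact (B := B) (e.toLinearMap ∘ₗ d ∘ₗ e.symm.toLinearMap)) : HomExact (B := B) d := by
  intro f hf
  obtain ⟨u, hu⟩ := h (f ∘ₗ e.symm.toLinearMap) (LinearMap.ext fun x => by
    simpa using LinearMap.congr_fun hf (e.symm x))
  exact ⟨u ∘ₗ e.toLinearMap, LinearMap.ext fun x => by
    simpa using LinearMap.congr_fun hu (e x)⟩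

theorem IsTac.conj {F F' : Type u} [AddCommGroup F] [Module R F] [AddCommGroup F']
    [Module R F'] {d : F →ₗ[R] F} (hd : IsTac d) (e : F ≃ₗ[R] F') :
    IsTac (e.toLinearMap ∘ₗ d ∘ₗ e.symm.toLinearMap) where
  sq x := by simp [hd.sq]
  homExact N _ _ hN := by
    refine HomExact.of_conj e.symm ?_
    convert hd.homExact N hN
    ext x
    simp

theorem IsTac.mem_range {F : Type u} [AddCommGroup F] [Module R F] (h : RightOrth R)
    {d : F →ₗ[R] F} (hd : IsTac d) {x : F} (hx : d x = 0) : ∃ y, d y = x := by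
  let I := Injective.under (ModuleCat.of R (F ⧸ LinearMap.range d))
  let j : (F ⧸ LinearMap.range d) →ₗ[R] I :=
    (Injective.ι (ModuleCat.of R (F ⧸ LinearMap.range d))).hom
  have hj : Function.Injective j := (ModuleCat.mono_iff_injective _).1
    (inferInstance : Mono (Injective.ι (ModuleCat.of R (F ⧸ LinearMap.range d))))
  obtain ⟨u, hu⟩ := hd.homExact I (h.finitePD_of_injective I) (j ∘ₗ (LinearMap.range d).mkQ)
    (LinearMap.ext fun x => by
      have : (LinearMap.range d).mkQ (d x) = 0 := (Submodule.Quotient.mk_eq_zero _).2 ⟨x, rfl⟩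
      simp only [LinearMap.comp_apply, this, map_zero, LinearMap.zero_apply])
  have := LinearMap.congr_fun hu x
  rw [LinearMap.comp_apply, hx, map_zero, LinearMap.comp_apply, eq_comm,
    map_eq_zero_iff _ hj] at this
  simpa using this

variable {ι : Type u}

theorem map_eq_sum_single {κ N : Type*} [AddCommGroup N] [Module R N] (f : (κ →₀ R) →ₗ[R] N)
    (x : κ →₀ R) : f x = x.sum fun j r => r • f (Finsupp.single j 1) := by
  conv_lhs => rw [← Finsupp.sum_single x]
  rw [map_finsuppSum]
  congr! with j r
  rw [← map_smul, Finsupp.smul_single_one]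

theorem IsTac.exists_finset (h : RightOrth R) {d : (ι →₀ R) →ₗ[R] (ι →₀ R)} (hd : IsTac d)
    (s : Finset ι) : ∃ t : Finset ι, s ⊆ t ∧
      ∀ (N : Type u) [AddCommGroup N] [Module R N], FinitePD R N → ∀ f : (ι →₀ R) →ₗ[R] N,
        (∀ j ∈ t, f (d (Finsupp.single j 1)) = 0) → ∃ f' : (ι →₀ R) →ₗ[R] N, f' ∘ₗ d = 0 ∧
          ∀ j ∈ s, f' (Finsupp.single j 1) = f (Finsupp.single j 1) := by
  classical
  by_contra! hcon
  have hcon' : ∀ t : Finset ι, _ := fun t => hcon (t ∪ s) Finset.subset_union_right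
  choose N i1 i2 hN f hf hf' using hcon'
  let X : ι → Set (Finset ι) := fun j => {t | j ∉ t ∪ s}
  let g : (ι →₀ R) →ₗ[R] piFinSupported R N X Set.univ Set.univ :=
    (LinearMap.pi fun t => f t ∘ₗ d).codRestrict _ fun x => by
      refine ⟨fun _ h => absurd trivial h, x.support, by simp, fun t ht => ?_⟩
      rw [LinearMap.pi_apply, map_eq_sum_single]
      refine Finset.sum_eq_zero fun j hj => ?_
      have : j ∈ t ∪ s := not_not.1 (ht j hj)
      simp [hf t j this]
  have hg : ∀ x t, (g x).1 t = f t (d x) := fun _ _ => rfl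
  obtain ⟨w, hw⟩ := hd.homExact _ (h.finitePD_piFinSupported N X hN) g (by
    ext x : 2
    apply Subtype.ext
    funext t
    simp [hg, hd.sq])
  choose T hT using fun j => (w (Finsupp.single j 1)).2.2
  let t := s.biUnion T
  obtain ⟨j, hj, hne⟩ := hf' t (f t - LinearMap.proj t ∘ₗ Submodule.subtype _ ∘ₗ w) (by
    ext x
    have := congrArg (fun q => q.1 t) (LinearMap.congr_fun hw (Finsupp.single x 1))
    simp only [LinearMap.comp_apply] at this
    simp [this, hg])
  apply hne
  have := (hT j).2 t fun i hi h => h (Finset.mem_union_left _ (Finset.mem_biUnion.2 ⟨j, hj, hi⟩))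
  simp [this]
end

section
variable {R : Type u} [Ring R] {ι : Type u} {B : Type u} [AddCommGroup B] [Module R B]

variable (R) in
noncomputable abbrev extendZero (D : Set ι) : (D →₀ R) →ₗ[R] (ι →₀ R) :=
  Finsupp.lmapDomain R R Subtype.val

variable (R) in
noncomputable abbrev restrictTo (D : Set ι) : (ι →₀ R) →ₗ[R] (D →₀ R) :=
  Finsupp.lsubtypeDomain D

theorem restrictTo_extendZero (D : Set ι) (x : D →₀ R) : restrictTo R D (extendZero R D x) = x := by
  ext i
  simp [Finsupp.lsubtypeDomain, Finsupp.mapDomain_apply Subtype.val_injective]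

theorem extendZero_apply_of_notMem (D : Set ι) (x : D →₀ R) {i : ι} (hi : i ∉ D) :
    extendZero R D x i = 0 :=
  Finsupp.mapDomain_of_notMem_range _ _ (by simpa using hi)

theorem extendZero_restrictTo {D : Set ι} {x : ι →₀ R} (hx : ∀ i ∉ D, x i = 0) :
    extendZero R D (restrictTo R D x) = x := by
  ext i
  by_cases hi : i ∈ D
  · exact Finsupp.mapDomain_apply Subtype.val_injective (restrictTo R D x) ⟨i, hi⟩
  · rw [extendZero_apply_of_notMem D _ hi, hx i hi]

theorem restrictTo_eq_zero {D : Set ι} {x : ι →₀ R} (hx : ∀ i ∈ D, x i = 0) :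
    restrictTo R D x = 0 := by
  ext i
  exact hx i i.2

theorem extendZero_restrictTo_compl (D : Set ι) (x : ι →₀ R) :
    extendZero R Dᶜ (restrictTo R Dᶜ x) = x - extendZero R D (restrictTo R D x) := by
  have h1 : ∀ i ∈ D, (x - extendZero R D (restrictTo R D x)) i = 0 := fun i hi => by
    rw [Finsupp.sub_apply, sub_eq_zero]
    exact (Finsupp.mapDomain_apply Subtype.val_injective (restrictTo R D x) ⟨i, hi⟩).symm
  rw [← extendZero_restrictTo (D := Dᶜ) (x := x - extendZero R D (restrictTo R D x))
    (fun i hi => h1 i (not_not.1 hi)), map_sub (restrictTo R Dᶜ),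
    restrictTo_eq_zero (D := Dᶜ) (x := extendZero R D _)
      (fun i hi => extendZero_apply_of_notMem D _ hi), sub_zero]

theorem extendZero_single (D : Set ι) (i : D) :
    extendZero R D (Finsupp.single i 1) = Finsupp.single (i : ι) 1 := by
  simp

variable (d : (ι →₀ R) →ₗ[R] (ι →₀ R))

/-- The compression of an endomorphism of a free module to a subset of the basis. -/
noncomputable def compress (D : Set ι) : (D →₀ R) →ₗ[R] (D →₀ R) :=
  restrictTo R D ∘ₗ d ∘ₗ extendZero R D

theorem compress_apply (D : Set ι) (x : D →₀ R) :
    compress d D x = restrictTo R D (d (extendZero R D x)) := rfl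

/-- The submodule spanned by the basis vectors in `D` is stable under `d`. -/
def IsStable (D : Set ι) : Prop := ∀ i ∈ D, ∀ j ∉ D, d (Finsupp.single i 1) j = 0

variable (B) in
/-- A version of `HomExact` for the span of the basis vectors in `D`. -/
def HomExactOn (D : Set ι) : Prop :=
  ∀ f : (ι →₀ R) →ₗ[R] B, (∀ i ∈ D, f (d (Finsupp.single i 1)) = 0) →
    ∃ u : (ι →₀ R) →ₗ[R] B, ∀ i ∈ D, u (d (Finsupp.single i 1)) = f (Finsupp.single i 1)

variable {d}

theorem IsStable.apply {D : Set ι} (h : IsStable d D) {x : ι →₀ R} (hx : ∀ i ∉ D, x i = 0)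
    {j : ι} (hj : j ∉ D) : d x j = 0 := by
  rw [map_eq_sum_single, Finsupp.sum, Finsupp.finsetSum_apply]
  refine Finset.sum_eq_zero fun i hi => ?_
  have : i ∈ D := not_not.1 fun h' => Finsupp.mem_support_iff.1 hi (hx i h')
  simp [h i this j hj]

theorem IsStable.extendZero_compress {D : Set ι} (h : IsStable d D) (x : D →₀ R) :
    extendZero R D (compress d D x) = d (extendZero R D x) :=
  extendZero_restrictTo fun _ hi => h.apply (fun _ hi => extendZero_apply_of_notMem D x hi) hi

theorem IsStable.homExact_compress_iff {D : Set ι} (h : IsStable d D) :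
    HomExact (B := B) (compress d D) ↔ HomExactOn B d D := by
  constructor
  · intro H f hf
    obtain ⟨u, hu⟩ := H (f ∘ₗ extendZero R D) (by
      ext i
      simp [-Finsupp.lmapDomain_apply, h.extendZero_compress]
      simp [hf i i.2])
    refine ⟨u ∘ₗ restrictTo R D, fun i hi => ?_⟩
    have := LinearMap.congr_fun hu (Finsupp.single ⟨i, hi⟩ 1)
    simp only [LinearMap.comp_apply, compress_apply, extendZero_single] at this
    exact this
  · intro H f hf
    obtain ⟨u, hu⟩ := H (f ∘ₗ restrictTo R D) fun i hi => by
      have := LinearMap.congr_fun hf (Finsupp.single ⟨i, hi⟩ 1)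
      simp only [LinearMap.comp_apply, compress_apply, extendZero_single] at this
      exact this
    refine ⟨u ∘ₗ extendZero R D, ?_⟩
    ext i
    have := hu i i.2
    rw [← extendZero_single, ← h.extendZero_compress, LinearMap.comp_apply,
      restrictTo_extendZero] at this
    exact this

theorem IsStable.isTac_compress {D : Set ι} (h : IsStable d D) (hd : ∀ x, d (d x) = 0)
    (H : ∀ (N : Type u) [AddCommGroup N] [Module R N], FinitePD R N → HomExactOn N d D) :
    IsTac (compress d D) where
  sq x := by
    rw [compress_apply, h.extendZero_compress, hd, map_zero]
  homExact N _ _ hN := h.homExact_compress_iff.2 (H N hN)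

theorem IsTac.compress_compl {D : Set ι} (h : IsStable d D) (hd : IsTac d)
    (H : ∀ (N : Type u) [AddCommGroup N] [Module R N], FinitePD R N → HomExactOn N d D) :
    IsTac (compress d Dᶜ) where
  sq x := by
    have h0 : ∀ y : D →₀ R, restrictTo R Dᶜ (extendZero R D y) = 0 := fun y =>
      restrictTo_eq_zero fun i hi => extendZero_apply_of_notMem D _ hi
    rw [compress_apply, compress_apply, extendZero_restrictTo_compl, map_sub, hd.sq,
      ← h.extendZero_compress, zero_sub, map_neg, h0, neg_zero]
  homExact N _ _ hN := by
    intro f hf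
    have hf' : ∀ x, f (restrictTo R Dᶜ (d (extendZero R Dᶜ x))) = 0 := LinearMap.congr_fun hf
    have h0 : ∀ y : D →₀ R, restrictTo R Dᶜ (extendZero R D y) = 0 := fun y =>
      restrictTo_eq_zero fun i hi => extendZero_apply_of_notMem D _ hi
    obtain ⟨u, hu⟩ := hd.homExact N hN (f ∘ₗ restrictTo R Dᶜ) (by
      refine LinearMap.ext fun x => ?_
      have := hf' (restrictTo R Dᶜ x)
      rw [extendZero_restrictTo_compl, map_sub, ← h.extendZero_compress, map_sub, h0,
        sub_zero] at this
      exact this)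
    have hu' : ∀ x, u (d x) = f (restrictTo R Dᶜ x) := LinearMap.congr_fun hu
    obtain ⟨v, hv⟩ := H N hN u fun i hi => by
      rw [hu', ← extendZero_single D ⟨i, hi⟩, h0, map_zero]
    have hv' : ∀ y : D →₀ R, v (d (extendZero R D y)) = u (extendZero R D y) := fun y => by
      rw [← LinearMap.comp_apply, ← LinearMap.comp_apply, ← LinearMap.comp_apply]
      congr 1
      ext i
      simpa using hv i i.2
    refine ⟨(u - v ∘ₗ d) ∘ₗ extendZero R Dᶜ, LinearMap.ext fun x => ?_⟩
    simp only [LinearMap.comp_apply, compress_apply, LinearMap.sub_apply]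
    rw [extendZero_restrictTo_compl, map_sub d, hd.sq, map_sub u, hu', zero_sub, map_neg v, hv',
      restrictTo_extendZero]
    abel

/-- Extension of exactness of `Hom(-, B)` from a stable set `D` by a stable set of the quotient. -/
theorem IsStable.extend_solution {D : Set ι} (h : IsStable d D) {s : Set (Dᶜ : Set ι)}
    (hs : HomExactOn B (compress d Dᶜ) s) (f : (ι →₀ R) →ₗ[R] B)
    (hf : ∀ i ∈ Subtype.val '' s, f (d (Finsupp.single i 1)) = 0)
    (hdd : ∀ x, d (d x) = 0)
    (u : (ι →₀ R) →ₗ[R] B) (hu : ∀ i ∈ D, u (d (Finsupp.single i 1)) = f (Finsupp.single i 1)) :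
    ∃ u' : (ι →₀ R) →ₗ[R] B, (∀ x : ι →₀ R, (∀ i ∉ D, x i = 0) → u' x = u x) ∧
      ∀ i ∈ D ∪ Subtype.val '' s, u' (d (Finsupp.single i 1)) = f (Finsupp.single i 1) := by
  have hg0 : ∀ y : D →₀ R, u (d (extendZero R D y)) = f (extendZero R D y) := fun y => by
    rw [← LinearMap.comp_apply, ← LinearMap.comp_apply, ← LinearMap.comp_apply]
    congr 1
    ext i
    simpa using hu i i.2
  obtain ⟨v, hv⟩ := hs ((f - u ∘ₗ d) ∘ₗ extendZero R Dᶜ) (by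
    intro i hi
    rw [LinearMap.comp_apply, compress_apply, extendZero_restrictTo_compl, extendZero_single,
      map_sub, LinearMap.sub_apply, LinearMap.sub_apply, hf _ ⟨i, hi, rfl⟩, LinearMap.comp_apply,
      hdd, LinearMap.comp_apply, hg0]
    simp)
  have hx0 : ∀ x : ι →₀ R, (∀ i ∉ D, x i = 0) → (v ∘ₗ restrictTo R Dᶜ) x = 0 := fun x hx => by
    rw [LinearMap.comp_apply, restrictTo_eq_zero (D := Dᶜ) hx, map_zero]
  refine ⟨u + v ∘ₗ restrictTo R Dᶜ, fun x hx => ?_, ?_⟩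
  · rw [LinearMap.add_apply, hx0 x hx, add_zero]
  · rintro i (hi | ⟨i, hi, rfl⟩)
    · rw [LinearMap.add_apply, hx0 _ (h i hi), add_zero, hu i hi]
    · have := hv i hi
      rw [compress_apply, extendZero_single, LinearMap.comp_apply, extendZero_single] at this
      rw [LinearMap.add_apply, LinearMap.comp_apply, this]
      simp

theorem IsStable.union {D : Set ι} (h : IsStable d D) {s : Set (Dᶜ : Set ι)}
    (hs : IsStable (compress d Dᶜ) s) : IsStable d (D ∪ Subtype.val '' s) := by
  rintro i (hi | ⟨i, hi, rfl⟩) j hj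
  · exact h i hi j fun h => hj (.inl h)
  · have := hs i hi ⟨j, fun h => hj (.inl h)⟩ fun h => hj (.inr ⟨_, h, rfl⟩)
    rw [compress_apply, extendZero_single] at this
    exact this
end

section
variable {R : Type u} [Ring R] {ι : Type u}

theorem IsTac.exists_countable (h : RightOrth R) {d : (ι →₀ R) →ₗ[R] (ι →₀ R)} (hd : IsTac d)
    (j : ι) : ∃ s : Set ι, j ∈ s ∧ s.Countable ∧ IsStable d s ∧
      ∀ (N : Type u) [AddCommGroup N] [Module R N], FinitePD R N → HomExactOn N d s := by
  classical
  choose T hT hT' using hd.exists_finset h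
  obtain ⟨t, ht0, ht⟩ : ∃ t : ℕ → Finset ι, t 0 = {j} ∧ ∀ n, t (n + 1) =
      T (t n) ∪ (t n).biUnion fun i => (d (Finsupp.single i 1)).support :=
    ⟨fun n => Nat.rec {j} (fun _ t => T t ∪ t.biUnion fun i => (d (Finsupp.single i 1)).support) n,
      rfl, fun _ => rfl⟩
  have hTt : ∀ n, T (t n) ⊆ t (n + 1) := fun n => ht n ▸ Finset.subset_union_left
  have hmono : Monotone t := monotone_nat_of_le_succ fun n => (hT _).trans (hTt n)
  have hsupp : ∀ n, ∀ i ∈ t n, ∀ k, d (Finsupp.single i 1) k ≠ 0 → k ∈ t (n + 1) := by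
    intro n i hi k hk
    rw [ht]
    exact Finset.mem_union_right _ (Finset.mem_biUnion.2 ⟨i, hi, Finsupp.mem_support_iff.2 hk⟩)
  refine ⟨{i | ∃ n, i ∈ t n}, ⟨0, ht0 ▸ Finset.mem_singleton_self j⟩, ?_, ?_, ?_⟩
  · have : {i | ∃ n, i ∈ t n} = ⋃ n, ((t n : Finset ι) : Set ι) := by ext; simp
    rw [this]
    exact Set.countable_iUnion fun n => (t n).countable_toSet
  · rintro i ⟨n, hi⟩ k hk
    by_contra hne
    exact hk ⟨n + 1, hsupp n i hi k hne⟩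
  · intro N _ _ hN f hf
    have hV : ∀ n, ∃ V : (ι →₀ R) →ₗ[R] N, ∀ i ∈ t n,
        V (d (Finsupp.single i 1)) = f (Finsupp.single i 1) := by
      intro n
      obtain ⟨f', hf', hff'⟩ := hT' (t n) N hN f fun i hi => hf i ⟨n + 1, hTt n hi⟩
      obtain ⟨V, rfl⟩ := hd.homExact N hN f' hf'
      exact ⟨V, hff'⟩
    have hstep : ∀ n, ∀ W : (ι →₀ R) →ₗ[R] N,
        (∀ i ∈ t (n + 1), W (d (Finsupp.single i 1)) = f (Finsupp.single i 1)) →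
        ∃ W' : (ι →₀ R) →ₗ[R] N,
        (∀ i ∈ t (n + 2), W' (d (Finsupp.single i 1)) = f (Finsupp.single i 1)) ∧
        ∀ i ∈ t n, W' (Finsupp.single i 1) = W (Finsupp.single i 1) := by
      intro n W hW
      obtain ⟨V, hV⟩ := hV (n + 2)
      obtain ⟨z, hz, hzz⟩ := hT' (t n) N hN (V - W) fun i hi => by
        have hi' := hTt n hi
        rw [LinearMap.sub_apply, hW i hi', hV i (hmono (Nat.le_succ _) hi'), sub_self]
      refine ⟨V - z, fun i hi => ?_, fun i hi => ?_⟩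
      · have : z (d (Finsupp.single i 1)) = 0 := LinearMap.congr_fun hz _
        rw [LinearMap.sub_apply, this, sub_zero, hV i hi]
      · rw [LinearMap.sub_apply, hzz i hi]
        simp
    choose! next hnext hnext' using hstep
    obtain ⟨W₀, hW₀⟩ := hV 1
    obtain ⟨W, hW0, hWs⟩ : ∃ W : ℕ → (ι →₀ R) →ₗ[R] N, W 0 = W₀ ∧
        ∀ n, W (n + 1) = next n (W n) :=
      ⟨fun n => Nat.rec W₀ next n, rfl, fun _ => rfl⟩
    have hW : ∀ n, ∀ i ∈ t (n + 1), W n (d (Finsupp.single i 1)) = f (Finsupp.single i 1) := by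
      intro n
      induction n with
      | zero => rw [hW0]; exact hW₀
      | succ n ih => rw [hWs]; exact hnext n _ ih
    have hWW : ∀ n, ∀ i ∈ t n, ∀ m, n ≤ m →
        W m (Finsupp.single i 1) = W n (Finsupp.single i 1) := by
      intro n i hi m hm
      induction m, hm using Nat.le_induction with
      | base => rfl
      | succ m hm ih => rw [← ih, hWs]; exact hnext' m _ (hW m) i (hmono hm hi)
    let k : ι → ℕ := fun i => if hi : ∃ n, i ∈ t n then Nat.find hi else 0
    have hk : ∀ i n, i ∈ t n → i ∈ t (k i) ∧ k i ≤ n := by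
      intro i n hi
      have hex : ∃ n, i ∈ t n := ⟨n, hi⟩
      simp only [k, dif_pos hex]
      exact ⟨Nat.find_spec hex, Nat.find_min' hex hi⟩
    refine ⟨Finsupp.linearCombination R fun i => W (k i) (Finsupp.single i 1), ?_⟩
    rintro i ⟨n, hi⟩
    rw [← hW (n + 1) i (hmono (by omega) hi), map_eq_sum_single (W (n + 1)),
      Finsupp.linearCombination_apply]
    refine Finset.sum_congr rfl fun l hl => ?_
    have hl' := hsupp n i hi l (Finsupp.mem_support_iff.1 hl)
    simp only
    rw [hWW (k l) l (hk l _ hl').1 (n + 1) (hk l _ hl').2]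
end

section
variable {R : Type u} [Ring R] {ι : Type u} {B : Type u} [AddCommGroup B] [Module R B]

variable (R B) in
/-- `Hom(-, B)` is exact on all differentials of `IsTac` type on free modules with countable
basis. -/
def HomExactCountable : Prop :=
  ∀ (σ : Set ℕ) (d : (σ →₀ R) →ₗ[R] (σ →₀ R)), IsTac d → HomExact (B := B) d

theorem HomExactCountable.homExact (hB : HomExactCountable R B) {s : Set ι} (hs : s.Countable)
    {d : (s →₀ R) →ₗ[R] (s →₀ R)} (hd : IsTac d) : HomExact (B := B) d := by
  obtain ⟨f, hf⟩ := hs.to_subtype.exists_injective_nat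
  let e : (s →₀ R) ≃ₗ[R] (Set.range f →₀ R) := Finsupp.domLCongr (Equiv.ofInjective f hf)
  exact HomExact.of_conj e (hB _ _ (hd.conj e))

theorem FinitePD.homExactCountable (hB : FinitePD R B) : HomExactCountable R B :=
  fun _ _ hd => hd.homExact B hB

/-- A stable set of basis vectors on which the differential is still of `IsTac` type. -/
structure IsGood (d : (ι →₀ R) →ₗ[R] (ι →₀ R)) (D : Set ι) : Prop where
  stable : IsStable d D
  homExactOn : ∀ (N : Type u) [AddCommGroup N] [Module R N], FinitePD R N → HomExactOn N d D

theorem IsGood.homExactOn_of_countable {d : (ι →₀ R) →ₗ[R] (ι →₀ R)} (hdd : ∀ x, d (d x) = 0)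
    {D : Set ι} (hD : IsGood d D) (hDc : D.Countable) (hB : HomExactCountable R B) :
    HomExactOn B d D :=
  hD.stable.homExact_compress_iff.1
    (hB.homExact hDc (hD.stable.isTac_compress hdd hD.homExactOn))

theorem exists_goodSucc (h : RightOrth R) {d : (ι →₀ R) →ₗ[R] (ι →₀ R)} (hd : IsTac d) :
    ∃ φ : Set ι → Set ι, (∀ D ≠ ⊤, D < φ D) ∧ φ ⊤ = ⊤ ∧ ∀ D ≠ ⊤, IsGood d D →
      ∃ s : Set (Dᶜ : Set ι), φ D = D ∪ Subtype.val '' s ∧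
        IsStable (compress d Dᶜ) s ∧ ∀ (B : Type u) [AddCommGroup B] [Module R B],
          HomExactCountable R B → HomExactOn B (compress d Dᶜ) s := by
  classical
  have key : ∀ D : Set ι, ∃ D' : Set ι, (D ≠ ⊤ → D < D') ∧ (D = ⊤ → D' = ⊤) ∧
      (D ≠ ⊤ → IsGood d D → ∃ s : Set (Dᶜ : Set ι), D' = D ∪ Subtype.val '' s ∧
        IsStable (compress d Dᶜ) s ∧ ∀ (B : Type u) [AddCommGroup B] [Module R B],
          HomExactCountable R B → HomExactOn B (compress d Dᶜ) s) := by
    intro D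
    by_cases hD : D ≠ ⊤ ∧ IsGood d D
    · obtain ⟨hD1, hD⟩ := hD
      obtain ⟨j, hj⟩ := (Set.ne_univ_iff_exists_notMem D).1 hD1
      have ht := hd.compress_compl hD.stable hD.homExactOn
      obtain ⟨s, hjs, hsc, hss, hsN⟩ := ht.exists_countable h ⟨j, hj⟩
      refine ⟨D ∪ Subtype.val '' s, fun _ => ?_, fun hD' => (hD1 hD').elim,
        fun _ _ => ⟨s, rfl, hss, fun B _ _ hB => ?_⟩⟩
      · exact (Set.ssubset_iff_of_subset Set.subset_union_left).2 ⟨j, .inr ⟨_, hjs, rfl⟩, hj⟩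
      · exact IsGood.homExactOn_of_countable ht.sq ⟨hss, hsN⟩ hsc hB
    · exact ⟨⊤, fun hD' => lt_top_iff_ne_top.2 hD', fun _ => rfl, fun h1 h2 => (hD ⟨h1, h2⟩).elim⟩
  choose φ h1 h2 h3 using key
  exact ⟨φ, h1, h2 ⊤ rfl, h3⟩

theorem IsStable.mem_supported {d : (ι →₀ R) →ₗ[R] (ι →₀ R)} {D : Set ι} (h : IsStable d D)
    {x : ι →₀ R} (hx : x ∈ Finsupp.supported R R D) : d x ∈ Finsupp.supported R R D := by
  rw [Finsupp.mem_supported'] at hx ⊢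
  exact fun j hj => h.apply hx hj

theorem eq_of_mem_supported {f g : (ι →₀ R) →ₗ[R] B} {D : Set ι}
    (h : ∀ i ∈ D, f (Finsupp.single i 1) = g (Finsupp.single i 1)) {x : ι →₀ R}
    (hx : x ∈ Finsupp.supported R R D) : f x = g x := by
  rw [Finsupp.supported_eq_span_single] at hx
  refine LinearMap.eqOn_span ?_ hx
  rintro _ ⟨i, hi, rfl⟩
  exact h i hi

theorem IsTac.homExactOn_transfiniteIterate [Nontrivial R] {d : (ι →₀ R) →ₗ[R] (ι →₀ R)}
    (hd : IsTac d)
    {φ : Set ι → Set ι} (hφ : ∀ D ≠ ⊤, D < φ D) (hφtop : φ ⊤ = ⊤)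
    (hφs : ∀ D ≠ ⊤, IsGood d D →
      ∃ s : Set (Dᶜ : Set ι), φ D = D ∪ Subtype.val '' s ∧
        IsStable (compress d Dᶜ) s ∧ ∀ (B : Type u) [AddCommGroup B] [Module R B],
          HomExactCountable R B → HomExactOn B (compress d Dᶜ) s)
    {J : Type u} [LinearOrder J] [OrderBot J] [SuccOrder J] [WellFoundedLT J] (k : J)
    (hk : ∀ j < k, IsGood d (transfiniteIterate φ j ∅))
    (hst : IsStable d (transfiniteIterate φ k ∅)) (hB : HomExactCountable R B) :
    HomExactOn B d (transfiniteIterate φ k ∅) := by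
  classical
  have hle : ∀ D, D ≤ φ D := fun D => by
    by_cases h : D = ⊤
    · rw [h, hφtop]
    · exact (hφ D h).le
  set D : J → Set ι := fun j => transfiniteIterate φ j ∅ with hDdef
  have hmono : Monotone D := monotone_transfiniteIterate φ ∅ hle
  have hSmono : Monotone fun j => Finsupp.supported R R (D j) :=
    fun i j hij => Finsupp.supported_mono (hmono hij)
  intro f hf
  suffices ∃ u : (ι →₀ R) →ₗ[R] B, ∀ x ∈ Finsupp.supported R R (D k),
      ∀ y ∈ Finsupp.supported R R (D k), d x = y → u y = f x by
    obtain ⟨u, hu⟩ := this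
    have hi := fun i (hi : i ∈ D k) => Finsupp.single_mem_supported R (1 : R) hi
    exact ⟨u, fun i h => hu _ (hi i h) _ (hst.mem_supported (hi i h)) rfl⟩
  refine exists_linearMap_of_chain_closed _
    ((fun j => Finsupp.supported R R (D j)) '' Set.Iic k) ?_ ?_ (fun x y b => d x = y → b = f x) ?_
    (by simp)
  · intro c hc _
    let A : Set J := {j | j ≤ k ∧ Finsupp.supported R R (D j) ∈ c}
    obtain ⟨m, hmA, hmin⟩ := WellFounded.has_min (wellFounded_lt (α := J)) (upperBounds A)
      ⟨k, fun j hj => hj.1⟩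
    have hmk : m ≤ k := not_lt.1 (hmin k fun j hj => hj.1)
    refine ⟨m, hmk, le_antisymm ?_ (sSup_le fun S hS => ?_)⟩
    · by_cases hm : m ∈ A
      · exact le_sSup hm.2
      · have hlt : ∀ a ∈ A, a < m := fun a ha => lt_of_le_of_ne (hmA ha) fun h => hm (h ▸ ha)
        induction m using SuccOrder.limitRecOn with
        | isMin m h =>
          obtain rfl := h.eq_bot
          simp [hDdef]
        | succ j hj _ =>
          exact (hmin j (fun a ha => (Order.lt_succ_iff_of_not_isMax hj).1 (hlt a ha))
            (Order.lt_succ_of_not_isMax hj)).elim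
        | isSuccLimit m hm' _ =>
          simp only [hDdef]
          rw [transfiniteIterate_limit _ _ _ hm', Set.iSup_eq_iUnion, Finsupp.supported_iUnion]
          refine iSup_le fun i => ?_
          have : (i : J) ∉ upperBounds A := fun h => hmin _ h i.2
          simp only [upperBounds, Set.mem_ofPred_eq, not_forall, not_le] at this
          obtain ⟨a, ha, hia⟩ := this
          exact (hSmono hia.le).trans (le_sSup ha.2)
    · obtain ⟨j, hj, rfl⟩ := hc hS
      exact hSmono (hmA ⟨hj, hS⟩)
  · rintro _ ⟨j, hj, rfl⟩ f
    refine ⟨f ∘ₗ Finsupp.restrictDom R R (D j), fun x => ?_⟩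
    exact congrArg f (LinearMap.congr_fun (Finsupp.restrictDom_comp_subtype (D j)) x)
  · rintro _ ⟨j, hj, rfl⟩ hne u hu
    have hjk : j < k := lt_of_le_of_ne hj fun h => hne (by rw [h])
    have hmax : ¬ IsMax j := not_isMax_of_lt hjk
    have hjt : D j ≠ ⊤ := fun h => hne (by
      have : D k = ⊤ := top_le_iff.1 (h ▸ hmono hj)
      simp only [h, this])
    have hgood := hk j hjk
    obtain ⟨s, hs, hss, hsB⟩ := hφs _ hjt hgood
    have hsucc : D (Order.succ j) = D j ∪ Subtype.val '' s :=
      (transfiniteIterate_succ φ ∅ j hmax).trans hs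
    have hsk : Order.succ j ≤ k := Order.succ_le_of_lt hjk
    have hst : IsStable d (D (Order.succ j)) := hsucc ▸ hgood.stable.union hss
    obtain ⟨u', hu1, hu2⟩ := hgood.stable.extend_solution (hsB B hB) f
      (fun i hi => hf i (hmono hsk (hsucc ▸ .inr hi))) hd.sq u fun i hi =>
        hu _ (Finsupp.single_mem_supported R 1 hi) _
          (hgood.stable.mem_supported (Finsupp.single_mem_supported R 1 hi)) rfl
    refine ⟨_, ⟨_, hsk, rfl⟩, ?_, u', fun x hx => hu1 x ((Finsupp.mem_supported' R x).1 hx), ?_⟩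
    · refine lt_of_le_of_ne (hSmono (Order.le_succ j)) fun h => ?_
      have : D j < D (Order.succ j) := by
        simp only [hDdef]
        rw [transfiniteIterate_succ φ ∅ j hmax]
        exact hφ _ hjt
      obtain ⟨i, hi, hi'⟩ := Set.exists_of_ssubset this
      have h1 : Finsupp.single i (1 : R) ∈ Finsupp.supported R R (D j) :=
        h.symm.subst (motive := fun S => _ ∈ S) (Finsupp.single_mem_supported R 1 hi)
      exact one_ne_zero (by simpa using (Finsupp.mem_supported' R _).1 h1 i hi' : (1 : R) = 0)
    · rintro x hx _ - rfl
      exact eq_of_mem_supported (f := u' ∘ₗ d) (fun i hi => hu2 i (hsucc ▸ hi)) hx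

theorem IsTac.isGood_transfiniteIterate [Nontrivial R] {d : (ι →₀ R) →ₗ[R] (ι →₀ R)}
    (hd : IsTac d)
    {φ : Set ι → Set ι} (hφ : ∀ D ≠ ⊤, D < φ D) (hφtop : φ ⊤ = ⊤)
    (hφs : ∀ D ≠ ⊤, IsGood d D →
      ∃ s : Set (Dᶜ : Set ι), φ D = D ∪ Subtype.val '' s ∧
        IsStable (compress d Dᶜ) s ∧ ∀ (B : Type u) [AddCommGroup B] [Module R B],
          HomExactCountable R B → HomExactOn B (compress d Dᶜ) s)
    {J : Type u} [LinearOrder J] [OrderBot J] [SuccOrder J] [WellFoundedLT J] (k : J) :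
    IsGood d (transfiniteIterate φ k ∅) := by
  induction k using WellFoundedLT.induction with
  | ind k ih =>
  suffices hst : IsStable d (transfiniteIterate φ k ∅) from ⟨hst, fun N _ _ hN =>
    hd.homExactOn_transfiniteIterate hφ hφtop hφs k ih hst hN.homExactCountable⟩
  induction k using SuccOrder.limitRecOn with
  | isMin k hk =>
    obtain rfl := hk.eq_bot
    simp [IsStable]
  | succ k hk _ =>
    have hg := ih k (Order.lt_succ_of_not_isMax hk)
    rw [transfiniteIterate_succ _ _ _ hk]
    by_cases ht : transfiniteIterate φ k ∅ = ⊤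
    · rw [ht, hφtop]
      exact fun _ _ _ h => (h trivial).elim
    · obtain ⟨s, hs, hss, -⟩ := hφs _ ht hg
      rw [hs]
      exact hg.stable.union hss
  | isSuccLimit k hk _ =>
    rw [transfiniteIterate_limit _ _ _ hk, Set.iSup_eq_iUnion]
    intro i hi j hj
    obtain ⟨l, hl⟩ := Set.mem_iUnion.1 hi
    exact (ih l l.2).stable i hl j fun h => hj (Set.mem_iUnion.2 ⟨l, h⟩)

theorem HomExactCountable.homExact_of_isTac (h : RightOrth R) (hB : HomExactCountable R B)
    {d : (ι →₀ R) →ₗ[R] (ι →₀ R)} (hd : IsTac d) : HomExact (B := B) d := by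
  cases subsingleton_or_nontrivial R
  · intro f _
    have := Module.subsingleton R B
    exact ⟨0, LinearMap.ext fun x => Subsingleton.elim _ _⟩
  obtain ⟨φ, h1, h2, h3⟩ := exists_goodSucc h hd
  obtain ⟨J, hJ⟩ : ∃ J : Type u, ∀ f : J → Set ι, ¬ Function.Injective f :=
    ⟨Set (Set ι), Function.cantor_injective⟩
  have : Nonempty J := by
    by_contra hJ'
    rw [not_nonempty_iff] at hJ'
    exact hJ isEmptyElim fun x => isEmptyElim x
  obtain ⟨_, _⟩ := exists_wellFoundedLT J
  let : OrderBot J := WellFoundedLT.toOrderBot J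
  let : SuccOrder J := SuccOrder.ofLinearWellFoundedLT J
  obtain ⟨j, hj⟩ := top_mem_range_transfiniteIterate φ ∅ h1 h2 (J := J) (hJ _)
  have key := hd.homExactOn_transfiniteIterate h1 h2 h3 j
    (fun k _ => hd.isGood_transfiniteIterate h1 h2 h3 k)
    (hd.isGood_transfiniteIterate h1 h2 h3 j).stable hB
  rw [hj] at key
  intro f hf
  obtain ⟨u, hu⟩ := key f fun i _ => LinearMap.congr_fun hf _
  refine ⟨u, ?_⟩
  ext i
  exact hu i trivial
end

section
variable {R : Type u} [Ring R]

theorem HomExact.of_finitePD {F : Type u} [AddCommGroup F] [Module R F] [Module.Projective R F]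
    {d : F →ₗ[R] F} (hdd : ∀ x, d (d x) = 0)
    (hd : ∀ (Q : Type u) [AddCommGroup Q] [Module R Q], Module.Projective R Q →
      HomExact (B := Q) d)
    (N : Type u) [AddCommGroup N] [Module R N] (hN : FinitePD R N) : HomExact (B := N) d := by
  obtain ⟨n, hn⟩ := hN
  replace hn : HasProjectiveDimensionLT (ModuleCat.of R N) (n + 1) :=
    hasProjectiveDimensionLT_of_ge _ n (n + 1) n.le_succ
  induction n generalizing N with
  | zero =>
    exact hd N ((IsProjective.iff_projective N).2
      (projective_iff_hasProjectiveDimensionLT_one.2 hn))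
  | succ n ih =>
    let g := Finsupp.linearCombination R (id : N → N)
    have hg : Function.Surjective g := Finsupp.linearCombination_id_surjective R N
    have hP' : Projective (ModuleCat.of R (N →₀ R)) :=
      (IsProjective.iff_projective (N →₀ R)).1 inferInstance
    have hS := shortExact_of_linearMap (K := ModuleCat.of R (LinearMap.ker g))
      (P := ModuleCat.of R (N →₀ R)) (M := ModuleCat.of R N) (LinearMap.ker g).subtype g
      Subtype.val_injective hg (by simp)
    have hK : HasProjectiveDimensionLT (ModuleCat.of R (LinearMap.ker g)) (n + 1) :=
      (hS.hasProjectiveDimensionLT_X₃_iff n hP').1 hn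
    intro f hf
    obtain ⟨f', hf'⟩ := Module.projective_lifting_property g f hg
    have hf'x : ∀ x, g (f' x) = f x := LinearMap.congr_fun hf'
    obtain ⟨v, hv⟩ := ih (LinearMap.ker g) hK ((f' ∘ₗ d).codRestrict _ fun x => by
      rw [LinearMap.mem_ker, LinearMap.comp_apply, hf'x]
      exact LinearMap.congr_fun hf x) (LinearMap.ext fun x => Subtype.ext (by simp [hdd]))
    have hvx : ∀ x, (v (d x) : N →₀ R) = f' (d x) := fun x =>
      congrArg Subtype.val (LinearMap.congr_fun hv x)
    obtain ⟨u, hu⟩ := hd (N →₀ R) inferInstance (f' - (LinearMap.ker g).subtype ∘ₗ v)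
      (LinearMap.ext fun x => by simp [hvx])
    refine ⟨g ∘ₗ u, LinearMap.ext fun x => ?_⟩
    have := LinearMap.congr_fun hu x
    rw [LinearMap.comp_apply] at this
    rw [LinearMap.comp_apply, LinearMap.comp_apply, this, LinearMap.sub_apply, map_sub, hf'x]
    simp

theorem HomExactCountable.homExact_of_isTac_of_projective (h : RightOrth R) {B : Type u}
    [AddCommGroup B] [Module R B] (hB : HomExactCountable R B)
    {F : Type u} [AddCommGroup F] [Module R F] [Module.Projective R F]
    {d : F →ₗ[R] F} (hd : IsTac d) : HomExact (B := B) d := by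
  obtain ⟨i, hi⟩ := Module.projective_def'.1 (inferInstance : Module.Projective R F)
  set s := Finsupp.linearCombination R (id : F → F) with hs
  have hsi : ∀ x, s (i x) = x := LinearMap.congr_fun hi
  clear_value s
  let D : ((F →₀ R) × (F →₀ R)) →ₗ[R] ((F →₀ R) × (F →₀ R)) :=
    (i ∘ₗ d ∘ₗ s ∘ₗ LinearMap.fst R _ _ + LinearMap.snd R _ _ - i ∘ₗ s ∘ₗ LinearMap.snd R _ _).prod
      (i ∘ₗ d ∘ₗ s ∘ₗ LinearMap.snd R _ _)
  have hD : ∀ x y, D (x, y) = (i (d (s x)) + y - i (s y), i (d (s y))) := fun _ _ => rfl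
  have hDt : IsTac D := by
    refine ⟨fun x => ?_, fun N _ _ hN g hg => ?_⟩
    · obtain ⟨x, y⟩ := x
      simp [hD, hsi, hd.sq]
    · have hg : ∀ x y, g (i (d (s x)) + y - i (s y), i (d (s y))) = 0 := fun x y =>
        LinearMap.congr_fun hg (x, y)
      obtain ⟨u₁, hu₁⟩ := hd.homExact N hN (g ∘ₗ LinearMap.inl R _ _ ∘ₗ i)
        (LinearMap.ext fun z => by simpa [hsi] using hg (i z) 0)
      obtain ⟨u₂, hu₂⟩ := hd.homExact N hN (g ∘ₗ LinearMap.inr R _ _ ∘ₗ i)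
        (LinearMap.ext fun z => by simpa [hsi] using hg 0 (i z))
      have hu₁ : ∀ z, u₁ (d z) = g (i z, 0) := LinearMap.congr_fun hu₁
      have hu₂ : ∀ z, u₂ (d z) = g (0, i z) := LinearMap.congr_fun hu₂
      refine ⟨u₁ ∘ₗ s ∘ₗ LinearMap.fst R _ _ + g ∘ₗ LinearMap.inr R _ _ ∘ₗ
        (LinearMap.id - i ∘ₗ s) ∘ₗ LinearMap.fst R _ _ + u₂ ∘ₗ s ∘ₗ LinearMap.snd R _ _,
        LinearMap.ext fun z => ?_⟩
      obtain ⟨x, y⟩ := z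
      have h1 := hg 0 (x - i (s x))
      simp only [map_sub, hsi, sub_self, map_zero, zero_add, sub_zero] at h1
      simp only [LinearMap.comp_apply, LinearMap.add_apply, hD, LinearMap.fst_apply,
        LinearMap.snd_apply, LinearMap.inr_apply, LinearMap.sub_apply, LinearMap.id_apply,
        map_sub, map_add, hsi, hu₁, hu₂]
      have e : (x, y) = (i (s x), 0) + (x - i (s x), 0) + (0, y - i (s y)) +
        ((0, i (s y)) : (F →₀ R) × (F →₀ R)) := by simp
      have e' : ((0, y - i (s y)) : (F →₀ R) × (F →₀ R)) = (0, y) - (0, i (s y)) := by simp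
      rw [e, map_add, map_add, map_add, h1, e', map_sub]
      simp
  let e := (Finsupp.sumFinsuppLEquivProdFinsupp R (M := R) (α := F) (β := F)).symm
  have key := HomExact.of_conj e (hB.homExact_of_isTac h (hDt.conj e))
  intro f hf
  have hf : ∀ x, f (d x) = 0 := LinearMap.congr_fun hf
  obtain ⟨u, hu⟩ := key (f ∘ₗ s ∘ₗ LinearMap.fst R _ _) (LinearMap.ext fun ⟨x, y⟩ => by
    simp [hD, hsi, hf])
  refine ⟨u ∘ₗ LinearMap.inl R _ _ ∘ₗ i, LinearMap.ext fun z => ?_⟩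
  have := LinearMap.congr_fun hu (i z, 0)
  simpa [hD, hsi] using this

/-- The total endomorphism of the direct sum of the terms of a complex. -/
noncomputable def totalDifferential {P : ℤ → ModuleCat.{u} R} (d : ∀ i : ℤ, P i →ₗ[R] P (i + 1)) :
    (DirectSum ℤ fun i => P i) →ₗ[R] DirectSum ℤ fun i => P i :=
  DirectSum.toModule R ℤ _ fun i => DirectSum.lof R ℤ (fun i => P i) (i + 1) ∘ₗ d i

theorem totalDifferential_lof {P : ℤ → ModuleCat.{u} R} (d : ∀ i : ℤ, P i →ₗ[R] P (i + 1))
    (i : ℤ) (x : P i) : totalDifferential d (DirectSum.lof R ℤ (fun i => P i) i x) =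
      DirectSum.lof R ℤ (fun i => P i) (i + 1) (d i x) :=
  DirectSum.toModule_lof _ _ _

theorem totalDifferential_homExact {P : ℤ → ModuleCat.{u} R}
    (d : ∀ i : ℤ, P i →ₗ[R] P (i + 1)) {Q : Type u} [AddCommGroup Q] [Module R Q]
    (h : ∀ (i : ℤ) (f : P (i + 1) →ₗ[R] Q), f ∘ₗ d i = 0 →
        ∃ g : P (i + 1 + 1) →ₗ[R] Q, g ∘ₗ d (i + 1) = f) :
    HomExact (B := Q) (totalDifferential d) := by
  intro f hf
  have hf' : ∀ i x, f (DirectSum.lof R ℤ (fun i => P i) (i + 1) (d i x)) = 0 := fun i x => by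
    rw [← totalDifferential_lof]
    exact LinearMap.congr_fun hf _
  have hw : ∀ i : ℤ, ∃ w : P (i + 1) →ₗ[R] Q, ∀ x, w (d i x) =
      f (DirectSum.lof R ℤ (fun i => P i) i x) := by
    intro i
    obtain ⟨i, rfl⟩ : ∃ j, i = j + 1 := ⟨i - 1, by simp⟩
    obtain ⟨g, hg⟩ := h i (f ∘ₗ DirectSum.lof R ℤ (fun i => P i) (i + 1))
      (LinearMap.ext (hf' i))
    exact ⟨g, LinearMap.congr_fun hg⟩
  have hv : ∀ j : ℤ, ∃ v : P j →ₗ[R] Q, ∀ i (hij : i + 1 = j) (x : P i), v (hij ▸ d i x) =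
      f (DirectSum.lof R ℤ (fun i => P i) i x) := by
    intro j
    obtain ⟨i, rfl⟩ : ∃ i, j = i + 1 := ⟨j - 1, by simp⟩
    obtain ⟨w, hw⟩ := hw i
    refine ⟨w, fun i' hi' x => ?_⟩
    obtain rfl : i' = i := by omega
    exact hw x
  choose v hv using hv
  refine ⟨DirectSum.toModule R ℤ _ v, DirectSum.linearMap_ext R fun i => LinearMap.ext fun x => ?_⟩
  simp only [LinearMap.comp_apply]
  rw [totalDifferential_lof, DirectSum.toModule_lof]
  exact hv (i + 1) i rfl x

theorem IsGorensteinProjective.subsingleton_ext (h : RightOrth R) {G : ModuleCat.{u} R}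
    (hG : IsGorensteinProjective R G) {B : ModuleCat.{u} R} (hB : HomExactCountable R B) :
    Subsingleton (Abelian.Ext.{u} G B 1) := by
  obtain ⟨P, d, hP, hex, ⟨e⟩, hQ⟩ := hG
  have hdd : ∀ i x, d (i + 1) (d i x) = 0 := fun i x => (hex i).le ⟨x, rfl⟩
  have hsq : ∀ x, totalDifferential d (totalDifferential d x) = 0 := fun x => by
    rw [← LinearMap.comp_apply, ← LinearMap.zero_apply (σ₁₂ := RingHom.id R) x]
    congr 1
    refine DirectSum.linearMap_ext R fun i => LinearMap.ext fun x => ?_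
    simp only [LinearMap.comp_apply]
    rw [totalDifferential_lof, totalDifferential_lof, hdd]
    simp
  have : Module.Projective R (DirectSum ℤ fun i => P i) := inferInstance
  have htac : IsTac (totalDifferential d) := ⟨hsq, HomExact.of_finitePD hsq fun Q _ _ hQ' =>
    totalDifferential_homExact d (hQ (ModuleCat.of R Q) hQ')⟩
  have key := hB.homExact_of_isTac_of_projective h htac
  generalize (0 : ℤ) = k at e
  obtain ⟨i, rfl⟩ : ∃ j, k = j + 1 := ⟨k - 1, by simp⟩
  have hS := shortExact_of_linearMap (K := ModuleCat.of R (LinearMap.ker (d (i + 1))))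
    (P := P (i + 1)) (M := G) (LinearMap.ker (d (i + 1))).subtype
    (e.symm.toLinearMap ∘ₗ (d (i + 1)).rangeRestrict) Subtype.val_injective
    (e.symm.surjective.comp (LinearMap.surjective_rangeRestrict _)) (by
      ext x
      simp [LinearMap.rangeRestrict])
  have hP' : Projective (P (i + 1)) := (IsProjective.iff_projective (P (i + 1))).1 (hP _)
  refine hS.subsingleton_ext_one_of_extension
    (subsingleton_ext_of_projective _ _ 0) fun φ => ?_
  let δ : P i →ₗ[R] LinearMap.ker (d (i + 1)) := (d i).codRestrict _ (hdd i)
  obtain ⟨u, hu⟩ := key (φ.hom ∘ₗ δ ∘ₗ DirectSum.component R ℤ (fun i => P i) i) (by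
    refine DirectSum.linearMap_ext R fun j => LinearMap.ext fun x => ?_
    simp only [LinearMap.comp_apply]
    rw [totalDifferential_lof]
    by_cases hj : j + 1 = i
    · subst hj
      rw [DirectSum.component.lof_self]
      have : δ (d j x) = 0 := Subtype.ext (hdd j x)
      rw [this, map_zero]
      rfl
    · rw [DirectSum.component.of, dif_neg hj, map_zero, map_zero]
      rfl)
  refine ⟨ModuleCat.ofHom (u ∘ₗ DirectSum.lof R ℤ (fun i => P i) (i + 1)), ?_⟩
  ext x
  obtain ⟨y, hy⟩ := (hex i).ge x.2
  have := LinearMap.congr_fun hu (DirectSum.lof R ℤ (fun i => P i) i y)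
  simp only [LinearMap.comp_apply] at this
  rw [totalDifferential_lof, DirectSum.component.lof_self] at this
  have hδ : δ y = x := Subtype.ext hy
  rw [hδ, hy] at this
  exact this

theorem HomExactCountable.finitePD (h : RightOrth R) {B : Type u} [AddCommGroup B] [Module R B]
    (hB : HomExactCountable R B) : FinitePD R B :=
  (h (ModuleCat.of R B)).1 fun _ hG => hG.subsingleton_ext h hB
end

section
open Limits MorphismProperty
open scoped ZeroObject

theorem hasSmallObjectArgument_ofHoms {C : Type*} [Category.{u} C] [Abelian C]
    [IsGrothendieckAbelian.{u} C] {ι : Type u} {X Y : ι → C} (f : ∀ i, X i ⟶ Y i)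
    [∀ i, Mono (f i)] : HasSmallObjectArgument.{u} (ofHoms f) := by
  obtain ⟨κ, hκ', hκ⟩ := HasCardinalLT.exists_regular_cardinal.{u} (Σ i, Subobject (X i))
  have : Fact κ.IsRegular := ⟨hκ'⟩
  have : Nonempty κ.ord.ToType := by simpa using hκ'.ne_zero
  have := WellFoundedLT.toOrderBot κ.ord.ToType
  have hle : ofHoms f ≤ monomorphisms C := (ofHoms_le_iff _ _).2 fun i => inferInstanceAs (Mono _)
  exact ⟨κ, inferInstance, inferInstance,
    { preservesColimit {A B X Y} i hi g hg := by
        let hg' : (monomorphisms C).TransfiniteCompositionOfShape κ.ord.ToType g :=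
          { toTransfiniteCompositionOfShape := hg.toTransfiniteCompositionOfShape
            map_mem j hj := by
              have := (hg.attachCells j hj).pushouts_coproducts
              simp only [ofHoms_homFamily] at this
              refine (?_ : _ ≤ monomorphisms C) _ this
              simp only [pushouts_le_iff, coproducts_le_iff]
              exact hle }
        have (j j' : κ.ord.ToType) (φ : j ⟶ j') : Mono (hg'.F.map φ) := hg'.mem_map φ
        apply IsGrothendieckAbelian.preservesColimit_coyoneda_obj_of_mono (Y := hg'.F) (κ := κ)
        obtain ⟨l⟩ := hi
        exact hκ.of_injective (fun S => ⟨l, S⟩) fun _ _ h => by simpa using h }⟩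

variable {R : Type u} [Ring R]

variable (R) in
/-- The inclusions of images of differentials of `IsTac` type on free modules with countable
basis. -/
def countableTacInclusions : MorphismProperty (ModuleCat.{u} R) :=
  ofHoms (X := fun i : Σ σ : Set ℕ, {d : (σ →₀ R) →ₗ[R] (σ →₀ R) // IsTac d} =>
      ModuleCat.of R (LinearMap.range i.2.1))
    (Y := fun i => ModuleCat.of R (i.1 →₀ R))
    fun i => ModuleCat.ofHom (LinearMap.range i.2.1).subtype

instance : HasSmallObjectArgument.{u} (countableTacInclusions R) :=
  have (i : Σ σ : Set ℕ, {d : (σ →₀ R) →ₗ[R] (σ →₀ R) // IsTac d}) :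
      Mono (ModuleCat.ofHom (X := LinearMap.range i.2.1) (Y := i.1 →₀ R)
        (LinearMap.range i.2.1).subtype) :=
    (ModuleCat.mono_iff_injective _).2 Subtype.val_injective
  hasSmallObjectArgument_ofHoms _

theorem rlp_of_finitePD {S : ShortComplex (ModuleCat.{u} R)} (hS : S.ShortExact)
    (h : FinitePD R S.X₁) : (countableTacInclusions R).rlp S.g := by
  rintro _ _ _ ⟨⟨σ, d, hd⟩⟩
  refine ⟨fun {t b} sq => ?_⟩
  have : Projective (ModuleCat.of R (σ →₀ R)) := (IsProjective.iff_projective _).1 inferInstance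
  have := hS.epi_g
  have := hS.mono_f
  obtain ⟨b', hb'⟩ : ∃ b' : ModuleCat.of R (σ →₀ R) ⟶ S.X₂, b' ≫ S.g = b :=
    ⟨Projective.factorThru b S.g, Projective.factorThru_comp _ _⟩
  let i : ModuleCat.of R (LinearMap.range d) ⟶ ModuleCat.of R (σ →₀ R) :=
    ModuleCat.ofHom (LinearMap.range d).subtype
  have hsq : t ≫ S.g = i ≫ b := sq.w
  obtain ⟨w, hw⟩ : ∃ w : ModuleCat.of R (LinearMap.range d) ⟶ S.X₁, w ≫ S.f = t - i ≫ b' :=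
    ⟨hS.exact.lift (t - i ≫ b') (by rw [Preadditive.sub_comp, hsq, Category.assoc, hb', sub_self]),
      hS.exact.lift_f _ _⟩
  obtain ⟨u, hu⟩ := hd.homExact S.X₁ h (w.hom ∘ₗ d.rangeRestrict) (LinearMap.ext fun x => by
    have : d.rangeRestrict (d x) = 0 := Subtype.ext (hd.sq x)
    rw [LinearMap.comp_apply, LinearMap.comp_apply, this, map_zero, LinearMap.zero_apply])
  have hu' : i ≫ ModuleCat.ofHom u = w := by
    ext ⟨_, x, rfl⟩
    exact LinearMap.congr_fun hu x
  refine ⟨⟨⟨b' + ModuleCat.ofHom u ≫ S.f, ?_, ?_⟩⟩⟩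
  · change i ≫ _ = t
    rw [Preadditive.comp_add, ← Category.assoc, hu', hw]
    abel
  · rw [Preadditive.add_comp, hb', Category.assoc, S.zero, comp_zero, add_zero]

theorem homExactCountable_of_rlp (h : RightOrth R) {B Z : ModuleCat.{u} R} (hZ : IsZero Z)
    (p : B ⟶ Z) (hp : (countableTacInclusions R).rlp p) : HomExactCountable R B := by
  intro σ d hd f hf
  have hker : LinearMap.ker d ≤ LinearMap.ker f := fun x hx => by
    obtain ⟨y, rfl⟩ := hd.mem_range h hx
    exact LinearMap.congr_fun hf y
  let t : LinearMap.range d →ₗ[R] B :=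
    (LinearMap.ker d).liftQ f hker ∘ₗ d.quotKerEquivRange.symm.toLinearMap
  have ht : ∀ x, t (d.rangeRestrict x) = f x := fun x => by
    have : d.quotKerEquivRange (Submodule.Quotient.mk x) = d.rangeRestrict x := rfl
    simp only [t, LinearMap.comp_apply, ← this, LinearEquiv.coe_coe, LinearEquiv.symm_apply_apply]
    exact Submodule.liftQ_apply _ _ _
  have := hp _ (ofHoms.mk (⟨σ, d, hd⟩ : Σ σ : Set ℕ, {d : (σ →₀ R) →ₗ[R] (σ →₀ R) // IsTac d}))
  have sq : CommSq (ModuleCat.ofHom t)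
      (ModuleCat.ofHom (X := LinearMap.range d) (Y := σ →₀ R) (LinearMap.range d).subtype) p 0 :=
    ⟨hZ.eq_of_tgt _ _⟩
  refine ⟨sq.lift.hom, LinearMap.ext fun x => ?_⟩
  rw [← ht]
  exact LinearMap.congr_fun (congrArg ModuleCat.Hom.hom sq.fac_left) (d.rangeRestrict x)

theorem RightOrth.exists_ses (h : RightOrth R) (M : ModuleCat.{u} R) :
    ∃ S : ShortComplex (ModuleCat.{u} R), S.ShortExact ∧ S.X₁ = M ∧ FinitePD R S.X₂ ∧
      ∀ N : ModuleCat.{u} R, FinitePD R N → Subsingleton (Abelian.Ext.{u} S.X₃ N 1) := by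
  let fac := factorizationData (countableTacInclusions R).rlp.llp (countableTacInclusions R).rlp
    (0 : M ⟶ 0)
  have hB : FinitePD R fac.Z :=
    (homExactCountable_of_rlp h (isZero_zero _) fac.p fac.hp).finitePD h
  have hmono : Mono fac.i := by
    obtain ⟨S, hS, hX, hI⟩ := exists_injective_ses M
    let φ : M ⟶ S.X₂ := eqToHom hX.symm ≫ S.f
    have := hS.mono_f
    have hrlp : (countableTacInclusions R).rlp (0 : S.X₂ ⟶ 0) :=
      rlp_of_finitePD (S := ShortComplex.mk (𝟙 S.X₂) (0 : S.X₂ ⟶ 0) (by simp))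
        (ShortComplex.Splitting.ofIsIsoOfIsZero _ (by dsimp; infer_instance)
          (isZero_zero _)).shortExact
        (h.finitePD_of_injective S.X₂)
    have := fac.hi _ hrlp
    have sq : CommSq φ fac.i (0 : S.X₂ ⟶ 0) 0 := ⟨by simp⟩
    have : Mono (fac.i ≫ sq.lift) := by
      rw [sq.fac_left]
      infer_instance
    exact mono_of_mono fac.i sq.lift
  refine ⟨ShortComplex.mk fac.i (cokernel.π fac.i) (by simp),
    { exact := ShortComplex.exact_cokernel _ }, rfl, hB, fun N hN => ?_⟩
  obtain ⟨S, hS, rfl, hI⟩ := exists_injective_ses N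
  refine hS.subsingleton_ext_one_of_lifting (subsingleton_ext_of_injective _ _ 0) fun φ => ?_
  have := fac.hi _ (rlp_of_finitePD hS hN)
  have sq : CommSq (0 : M ⟶ S.X₂) fac.i S.g (cokernel.π fac.i ≫ φ) := ⟨by simp⟩
  refine ⟨cokernel.desc fac.i sq.lift sq.fac_left, ?_⟩
  rw [← cancel_epi (cokernel.π fac.i), ← Category.assoc, cokernel.π_desc, sq.fac_right]
end

section
variable {R : Type u} [Ring R]

theorem RightOrth.subsingleton_ext_succ (h : RightOrth R) {M : ModuleCat.{u} R}
    (hM : ∀ N : ModuleCat.{u} R, FinitePD R N → Subsingleton (Abelian.Ext.{u} M N 1)) (k : ℕ)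
    (N : ModuleCat.{u} R) (hN : FinitePD R N) : Subsingleton (Abelian.Ext.{u} M N (k + 1)) := by
  induction k generalizing N with
  | zero => exact hM N hN
  | succ k ih =>
    obtain ⟨S, hS, rfl, hI⟩ := exists_injective_ses N
    refine hS.subsingleton_ext_covariant₁ (ih _ ?_) (subsingleton_ext_of_injective _ _ _)
    obtain ⟨n, hn⟩ := hN
    obtain ⟨m, hm⟩ := h.finitePD_of_injective S.X₂
    have hn' : HasProjectiveDimensionLT S.X₁ n := hn
    have hm' : HasProjectiveDimensionLT S.X₂ m := hm
    exact ⟨max n m + 1, hS.hasProjectiveDimensionLT_X₃ (max n m)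
      (hasProjectiveDimensionLT_of_ge _ n _ (by omega))
      (hasProjectiveDimensionLT_of_ge _ m _ (by omega))⟩

theorem RightOrth.subsingleton_ext_of_bound (h : RightOrth R) {n : ℕ}
    (hn : ∀ N : ModuleCat.{u} R, FinitePD R N → HasProjectiveDimensionLT N (n + 1))
    (M N : ModuleCat.{u} R) (hN : FinitePD R N) : Subsingleton (Abelian.Ext.{u} M N (n + 1)) := by
  obtain ⟨S, hS, rfl, hX, hA⟩ := h.exists_ses M
  have := hn _ hX
  exact hS.subsingleton_ext_contravariant₁
    (HasProjectiveDimensionLT.subsingleton S.X₂ (n + 1) (n + 1) le_rfl N)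
    (h.subsingleton_ext_succ hA _ N hN)

theorem gpdLE_of_subsingleton_ext
    (h1 : ∀ M : ModuleCat.{u} R, IsGorensteinProjective R M ↔
      ∀ N : ModuleCat.{u} R, FinitePD R N → Subsingleton (Abelian.Ext.{u} M N 1)) {n : ℕ}
    {M : ModuleCat.{u} R}
    (hM : ∀ N : ModuleCat.{u} R, FinitePD R N → Subsingleton (Abelian.Ext.{u} M N (n + 1))) :
    gpdLE R n M := by
  induction n generalizing M with
  | zero => exact (h1 M).2 hM
  | succ n ih =>
    let g := Finsupp.linearCombination R (id : M → M)
    have hg : Function.Surjective g := Finsupp.linearCombination_id_surjective R M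
    have hP : Projective (ModuleCat.of R (M →₀ R)) :=
      (IsProjective.iff_projective (M →₀ R)).1 inferInstance
    have hS := shortExact_of_linearMap (K := ModuleCat.of R (LinearMap.ker g))
      (P := ModuleCat.of R (M →₀ R)) (M := M) (LinearMap.ker g).subtype g
      Subtype.val_injective hg (by simp)
    exact ⟨ModuleCat.of R (LinearMap.ker g), ModuleCat.of R (M →₀ R), (LinearMap.ker g).subtype,
      g, (h1 _).2 fun N _ => subsingleton_ext_of_projective _ N 0, Subtype.val_injective, hg,
      by simp, ih fun N hN => hS.subsingleton_ext_contravariant₁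
        (subsingleton_ext_of_projective (ModuleCat.of R (M →₀ R)) N n) (hM N hN)⟩

theorem RightOrth.subsingleton_ext_of_gpdLE (h : RightOrth R)
    (h1 : ∀ M : ModuleCat.{u} R, IsGorensteinProjective R M →
      ∀ N : ModuleCat.{u} R, FinitePD R N → Subsingleton (Abelian.Ext.{u} M N 1)) {k i : ℕ}
    {M : ModuleCat.{u} R} (hM : gpdLE R k M) (hi : k ≤ i) (N : ModuleCat.{u} R)
    (hN : FinitePD R N) : Subsingleton (Abelian.Ext.{u} M N (i + 1)) := by
  induction k generalizing M i with
  | zero => exact h.subsingleton_ext_succ (h1 M hM) i N hN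
  | succ k ih =>
    obtain ⟨K, G, f, g, hG, hf, hg, hfg, hK⟩ := hM
    obtain ⟨i, rfl⟩ : ∃ j, i = j + 1 := ⟨i - 1, by omega⟩
    exact (shortExact_of_linearMap f g hf hg hfg).subsingleton_ext_contravariant₃
      (ih hK (by omega)) (h.subsingleton_ext_succ (h1 G hG) (i + 1) N hN)

theorem RightOrth.hasProjectiveDimensionLT_of_gpdLE (h : RightOrth R)
    (h1 : ∀ M : ModuleCat.{u} R, IsGorensteinProjective R M →
      ∀ N : ModuleCat.{u} R, FinitePD R N → Subsingleton (Abelian.Ext.{u} M N 1)) {k m : ℕ}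
    {M : ModuleCat.{u} R} (hM : gpdLE R k M) (hm : HasProjectiveDimensionLT M m) :
    HasProjectiveDimensionLT M (k + 1) := by
  induction m with
  | zero => exact hasProjectiveDimensionLT_of_ge _ 0 _ (by omega)
  | succ m ih =>
    by_cases hmk : m ≤ k
    · exact hasProjectiveDimensionLT_of_ge _ (m + 1) _ (by omega)
    refine ih ((hasProjectiveDimensionLT_iff.{u} M m).2 fun i hi N e => ?_)
    suffices Subsingleton (Abelian.Ext.{u} M N i) from Subsingleton.elim _ _
    obtain ⟨i, rfl⟩ : ∃ j, i = j + 1 := ⟨i - 1, by omega⟩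
    obtain ⟨S, hS, rfl, hP⟩ := exists_projective_ses N
    exact hS.subsingleton_ext_covariant₃
      (h.subsingleton_ext_of_gpdLE h1 hM (by omega) S.X₂
        FinitePD.of_projective)
      (HasProjectiveDimensionLT.subsingleton M (m + 1) _ (by omega) _)

theorem projDim_le_iff (M : ModuleCat.{u} R) (n : ℕ) :
    projDim R M ≤ n ↔ HasProjectiveDimensionLT M (n + 1) := by
  constructor
  · intro hM
    have hne : {n : ℕ∞ | ∃ m : ℕ, n = (m : ℕ∞) ∧ projDimLE R m M}.Nonempty := by
      by_contra hne
      rw [Set.not_nonempty_iff_eq_empty] at hne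
      rw [projDim, hne, sInf_empty] at hM
      exact absurd hM (by simp)
    obtain ⟨m, hm, hm'⟩ := csInf_mem hne
    have hmn : m ≤ n := by
      rw [projDim, hm] at hM
      exact_mod_cast hM
    have := (projDimLE_iff m M).1 hm'
    exact hasProjectiveDimensionLT_of_ge _ (m + 1) _ (by omega)
  · exact fun hM => sInf_le ⟨n, rfl, (projDimLE_iff n M).2 hM⟩
end

/-- If `GP(R) = ^⊥(P̄(R))` and `GP(R)^⊥ = P̄(R)` (where `P̄(R)` is the class of modules of
finite projective dimension), then `FPD(R) = l.Ggldim(R)`. -/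
theorem FPD_eq_leftGgldim (R : Type u) [Ring R]
    (h1 : ∀ M : ModuleCat.{u} R, IsGorensteinProjective R M ↔
      ∀ N : ModuleCat.{u} R, projDim R N ≠ ⊤ → extVanish R 1 M N)
    (h2 : ∀ M : ModuleCat.{u} R,
      (∀ G, IsGorensteinProjective R G → extVanish R 1 G M) ↔ projDim R M ≠ ⊤) :
    FPD R = leftGgldim R := by
  simp only [extVanish_iff, projDim_ne_top_iff] at h1 h2
  have h : RightOrth R := h2
  have h1' := fun M => (h1 M).1
  apply le_antisymm
  · refine iSup₂_le fun M hM =>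
      (le_sInf ?_ : projDim R M ≤ gpd R M).trans (le_iSup (gpd R) M)
    rintro _ ⟨k, rfl, hk⟩
    obtain ⟨m, hm⟩ := (projDim_ne_top_iff M).1 hM
    exact (projDim_le_iff M k).2 (h.hasProjectiveDimensionLT_of_gpdLE h1' hk hm)
  · have hle : ∀ N : ModuleCat.{u} R, FinitePD R N → projDim R N ≤ FPD R := fun N hN =>
      le_iSup₂ (f := fun (M : ModuleCat.{u} R) (_ : projDim R M ≠ ⊤) => projDim R M) N
        ((projDim_ne_top_iff N).2 hN)
    obtain ⟨b, hb⟩ := h.exists_bound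
    have hFPD : FPD R ≤ b := iSup₂_le fun M hM =>
      (projDim_le_iff M b).2 (hb M ((projDim_ne_top_iff M).1 hM))
    obtain ⟨n, hn⟩ := ENat.ne_top_iff_exists.1 (ne_top_of_le_ne_top (ENat.natCast_ne_top b) hFPD)
    rw [← hn] at hle ⊢
    refine iSup_le fun M => sInf_le ⟨n, rfl, gpdLE_of_subsingleton_ext h1 fun N hN =>
      h.subsingleton_ext_of_bound (fun N hN => (projDim_le_iff N n).1 (hle N hN)) M N hN⟩
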